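/- arXiv:1507.02753 — 3 statements merged into one kernel-verified Lean document; each statement's English description precedes it below -/
import Mathlib

section
/- Let n ≥ 3. The natural density of the set Ē ⊆ ℤ^{n+1} of shifted Eisenstein polynomials of degree n exists and equals 1 − ∏_{p prime} (1 − (p−1)²/p^{n+1}). -/
open Polynomial Filter

/-- A polynomial over `ℤ` is `p`-Eisenstein of degree `n`. -/
def IsEisensteinZ (p n : ℕ) (f : Polynomial ℤ) : Prop :=
  f.natDegree = n ∧ ¬ (p : ℤ) ∣ f.coeff n ∧ (∀ i < n, (p : ℤ) ∣ f.coeff i) ∧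
    ¬ (p : ℤ) ^ 2 ∣ f.coeff 0

/-- The polynomial with coefficient vector `a ∈ ℤ^{n+1}` (with respect to the
standard basis `1, x, …, xⁿ`). -/
noncomputable def toPolyZ (n : ℕ) (a : Fin (n + 1) → ℤ) : Polynomial ℤ :=
  ∑ i : Fin (n + 1), C (a i) * X ^ (i : ℕ)

namespace ShiftEis

/-- coefficient vector to polynomial over any ring -/
noncomputable def tp {R : Type*} [CommRing R] (n : ℕ) (a : Fin (n + 1) → R) : R[X] :=
  ∑ i : Fin (n + 1), C (a i) * X ^ (i : ℕ)

theorem tp_coeff {R : Type*} [CommRing R] (n : ℕ) (a : Fin (n + 1) → R) (m : ℕ) :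
    (tp n a).coeff m = if h : m < n + 1 then a ⟨m, h⟩ else 0 := by
  unfold tp
  simp only [finsetSum_coeff, coeff_C_mul, coeff_X_pow]
  split_ifs with h
  · rw [Finset.sum_eq_single ⟨m, h⟩]
    · simp
    · intro b _ hb
      have : m ≠ (b : ℕ) := fun h' => hb (by ext; simp [h'])
      simp [this]
    · simp
  · apply Finset.sum_eq_zero
    intro b _
    have : m ≠ (b : ℕ) := by have := b.2; omega
    simp [this]

theorem tp_coeff_fin {R : Type*} [CommRing R] (n : ℕ) (a : Fin (n + 1) → R) (j : Fin (n + 1)) :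
    (tp n a).coeff j = a j := by
  rw [tp_coeff, dif_pos j.2]

theorem tp_natDegree {R : Type*} [CommRing R] (n : ℕ) (a : Fin (n + 1) → R) :
    (tp n a).natDegree ≤ n := by
  rw [natDegree_le_iff_coeff_eq_zero]
  intro m hm
  rw [tp_coeff, dif_neg (by omega)]

theorem tp_of_coeff {R : Type*} [CommRing R] (n : ℕ) (f : R[X]) (hf : f.natDegree ≤ n) :
    tp n (fun j => f.coeff j) = f := by
  ext m
  rw [tp_coeff]
  split_ifs with h
  · rfl
  · rw [coeff_eq_zero_of_natDegree_lt (by omega)]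

/-- shift of a coefficient vector -/
noncomputable def sh {R : Type*} [CommRing R] (n : ℕ) (r : R) (a : Fin (n + 1) → R) :
    Fin (n + 1) → R := fun j => (taylor r (tp n a)).coeff j

theorem tp_sh {R : Type*} [CommRing R] (n : ℕ) (r : R) (a : Fin (n + 1) → R) :
    tp n (sh n r a) = taylor r (tp n a) := by
  apply tp_of_coeff
  rw [natDegree_taylor]
  exact tp_natDegree n a

theorem sh_sh {R : Type*} [CommRing R] (n : ℕ) (r s : R) (a : Fin (n + 1) → R) :
    sh n r (sh n s a) = sh n (r + s) a := by
  funext j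
  change (taylor r (tp n (sh n s a))).coeff j = (taylor (r + s) (tp n a)).coeff j
  rw [tp_sh, taylor_taylor]

theorem sh_zero {R : Type*} [CommRing R] (n : ℕ) (a : Fin (n + 1) → R) :
    sh n 0 a = a := by
  funext j
  unfold sh
  rw [taylor_zero, tp_coeff_fin]

theorem tp_map {R S : Type*} [CommRing R] [CommRing S] (φ : R →+* S) (n : ℕ)
    (a : Fin (n + 1) → R) : tp n (fun j => φ (a j)) = (tp n a).map φ := by
  simp [tp, Polynomial.map_sum]

theorem sh_map {R S : Type*} [CommRing R] [CommRing S] (φ : R →+* S) (n : ℕ) (r : R)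
    (a : Fin (n + 1) → R) : sh n (φ r) (fun j => φ (a j)) = fun j => φ (sh n r a j) := by
  funext j
  unfold sh
  rw [tp_map, ← map_taylor, coeff_map]

/-- abstract Eisenstein condition -/
def Eis {R : Type*} [CommRing R] (n : ℕ) (π : R) (a : Fin (n + 1) → R) : Prop :=
  ¬ π ∣ a (Fin.last n) ∧ (∀ j, j ≠ Fin.last n → π ∣ a j) ∧ ¬ π ^ 2 ∣ a 0

theorem decomp {R : Type*} [CommRing R] (n : ℕ) (π : R) (a : Fin (n + 1) → R)
    (h : ∀ j, j ≠ Fin.last n → π ∣ a j) :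
    ∃ g : R[X], tp n a = C (a (Fin.last n)) * X ^ n + C π * g ∧ ∀ m, n ≤ m → g.coeff m = 0 := by
  choose! b hb using h
  refine ⟨∑ i : Fin n, C (b i.castSucc) * X ^ (i : ℕ), ?_, ?_⟩
  · unfold tp
    rw [Fin.sum_univ_castSucc, add_comm]
    congr 1
    rw [Finset.mul_sum]
    apply Finset.sum_congr rfl
    intro i _
    rw [hb _ (Fin.castSucc_lt_last i).ne, C_mul]
    simp [mul_assoc]
  · intro m hm
    simp only [finsetSum_coeff, coeff_C_mul, coeff_X_pow]
    apply Finset.sum_eq_zero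
    intro i _
    have : m ≠ (i : ℕ) := by have := i.2; omega
    simp [this]

theorem sh_mod {R : Type*} [CommRing R] (n : ℕ) (π : R) (a : Fin (n + 1) → R)
    (h : ∀ j, j ≠ Fin.last n → π ∣ a j) (r : R) (j : Fin (n + 1)) :
    π ∣ sh n r a j - a (Fin.last n) * r ^ (n - (j : ℕ)) * (n.choose j : R) := by
  obtain ⟨g, hg, -⟩ := decomp n π a h
  unfold sh
  rw [hg, map_add, taylor_mul, taylor_mul, taylor_C, taylor_C, taylor_X_pow, coeff_add,
    coeff_C_mul, coeff_C_mul, coeff_X_add_C_pow]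
  exact ⟨(taylor r g).coeff j, by ring⟩

theorem Eis_sh_pi {R : Type*} [CommRing R] (n : ℕ) (hn : 2 ≤ n) (π k : R) (a : Fin (n + 1) → R)
    (h : Eis n π a) : Eis n π (sh n (π * k) a) := by
  obtain ⟨h1, h2, h3⟩ := h
  have hm := sh_mod n π a h2 (π * k)
  refine ⟨?_, ?_, ?_⟩
  · intro hd
    apply h1
    have := hm (Fin.last n)
    simp only [Fin.val_last, Nat.sub_self, pow_zero, mul_one, Nat.choose_self, Nat.cast_one] at this
    exact (dvd_sub_right hd).1 this
  · intro j hj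
    have := hm j
    have hlt : (j : ℕ) < n := by
      have := j.2
      have : (j : ℕ) ≠ n := fun h => hj (Fin.ext h)
      omega
    refine (dvd_sub_left ?_).1 this
    refine Dvd.dvd.mul_right (Dvd.dvd.mul_left ?_ _) _
    exact dvd_pow (dvd_mul_right _ _) (by omega)
  · intro hd
    apply h3
    obtain ⟨g, hg, -⟩ := decomp n π a h2
    have e0 : a 0 = π * g.coeff 0 := by
      rw [← tp_coeff_fin n a 0, hg]
      simp [coeff_X_pow, show ¬ 0 = n by omega]
    have e1 : sh n (π * k) a 0 = a (Fin.last n) * (π * k) ^ n + π * g.eval (π * k) := by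
      change (taylor (π * k) (tp n a)).coeff ((0 : Fin (n + 1)) : ℕ) = _
      rw [Fin.val_zero, taylor_coeff_zero, hg]
      simp
    have e2 : π * k - 0 ∣ g.eval (π * k) - g.eval 0 := sub_dvd_eval_sub _ _ _
    obtain ⟨t, ht⟩ := e2
    rw [← coeff_zero_eq_eval_zero, sub_zero] at ht
    obtain ⟨s, hs⟩ := hd
    obtain ⟨m, rfl⟩ : ∃ m, n = m + 2 := ⟨n - 2, by omega⟩
    refine ⟨s - a (Fin.last _) * (π * k) ^ m * k ^ 2 - k * t, ?_⟩
    rw [e1] at hs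
    rw [e0]
    linear_combination hs - π * ht

theorem toPolyZ_eq (n : ℕ) (a : Fin (n + 1) → ℤ) : toPolyZ n a = tp n a := rfl

theorem isEis_iff (n : ℕ) (p : ℕ) (i : ℤ) (a : Fin (n + 1) → ℤ) :
    IsEisensteinZ p n ((toPolyZ n a).comp (X + C i)) ↔ Eis n (p : ℤ) (sh n i a) := by
  rw [toPolyZ_eq, ← taylor_apply]
  unfold IsEisensteinZ Eis
  constructor
  · rintro ⟨-, h1, h2, h3⟩
    refine ⟨h1, fun j hj => h2 j ?_, h3⟩
    have := j.2
    have : (j : ℕ) ≠ n := fun h => hj (Fin.ext h)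
    omega
  · rintro ⟨h1, h2, h3⟩
    refine ⟨?_, h1, fun j hj => h2 ⟨j, by omega⟩ (fun h => ?_), h3⟩
    · apply natDegree_eq_of_le_of_coeff_ne_zero
      · rw [natDegree_taylor]; exact tp_natDegree n a
      · intro h
        apply h1
        simp [sh, h]
    · have := congrArg Fin.val h
      simp at this
      omega

theorem dvd_cast_iff (p : ℕ) (x : ℤ) :
    (p : ZMod (p ^ 2)) ∣ (x : ZMod (p ^ 2)) ↔ (p : ℤ) ∣ x := by
  constructor
  · rintro ⟨y, hy⟩
    obtain ⟨z, rfl⟩ := ZMod.intCast_surjective y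
    have : ((x - p * z : ℤ) : ZMod (p ^ 2)) = 0 := by push_cast; rw [hy]; ring
    rw [ZMod.intCast_zmod_eq_zero_iff_dvd] at this
    have h2 : (p : ℤ) ∣ x - p * z := dvd_trans (by push_cast; exact dvd_pow_self _ two_ne_zero) this
    exact (dvd_sub_left (dvd_mul_right _ _)).1 h2
  · rintro ⟨y, rfl⟩
    exact ⟨(y : ZMod (p ^ 2)), by push_cast; ring⟩

theorem Eis_cast (n p : ℕ) (a : Fin (n + 1) → ℤ) :
    Eis n (p : ℤ) a ↔ Eis n (p : ZMod (p ^ 2)) (fun j => ((a j : ℤ) : ZMod (p ^ 2))) := by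
  have key := dvd_cast_iff p
  have key2 : ∀ x : ℤ, (p : ZMod (p ^ 2)) ^ 2 ∣ (x : ZMod (p ^ 2)) ↔ (p : ℤ) ^ 2 ∣ x := by
    intro x
    have : (p : ZMod (p ^ 2)) ^ 2 = 0 := by
      have := ZMod.natCast_self (p ^ 2)
      push_cast at this
      exact this
    rw [this, zero_dvd_iff, ZMod.intCast_zmod_eq_zero_iff_dvd]
    push_cast
    rfl
  unfold Eis
  simp only [key, key2]

/-- local set of residues -/
def SP (n p : ℕ) : Set (Fin (n + 1) → ZMod (p ^ 2)) :=
  {a | ∃ r : ZMod (p ^ 2), Eis n (p : ZMod (p ^ 2)) (sh n r a)}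

theorem mem_SP (n p : ℕ) (a : Fin (n + 1) → ℤ) :
    (∃ i : ℤ, Eis n (p : ℤ) (sh n i a)) ↔ (fun j => ((a j : ℤ) : ZMod (p ^ 2))) ∈ SP n p := by
  have h : ∀ i : ℤ, Eis n (p : ℤ) (sh n i a) ↔
      Eis n (p : ZMod (p ^ 2)) (sh n ((i : ℤ) : ZMod (p ^ 2)) (fun j => ((a j : ℤ) : ZMod (p ^ 2)))) := by
    intro i
    rw [Eis_cast]
    have := sh_map (Int.castRingHom (ZMod (p ^ 2))) n i a
    simp only [eq_intCast] at this
    rw [this]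
  constructor
  · rintro ⟨i, hi⟩
    exact ⟨i, (h i).1 hi⟩
  · rintro ⟨r, hr⟩
    obtain ⟨i, rfl⟩ := ZMod.intCast_surjective r
    exact ⟨i, (h i).2 hr⟩

end ShiftEis

namespace ShiftEis
open Classical

theorem card_dvd (p : ℕ) [NeZero (p ^ 2)] (hp : p.Prime) :
    (Finset.univ.filter (fun x : ZMod (p ^ 2) => (p : ZMod (p ^ 2)) ∣ x)).card = p := by
  conv_rhs => rw [← Finset.card_range p]
  symm
  apply Finset.card_bij (fun k _ => ((p * k : ℕ) : ZMod (p ^ 2)))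
  · intro k _
    simp
  · intro k hk l hl h
    rw [ZMod.natCast_eq_natCast_iff, pow_two] at h
    have := Nat.ModEq.mul_left_cancel' hp.ne_zero h
    simp only [Finset.mem_range] at hk hl
    exact Nat.ModEq.eq_of_lt_of_lt this hk hl
  · intro x hx
    simp only [Finset.mem_filter, Finset.mem_univ, true_and] at hx
    obtain ⟨y, rfl⟩ := hx
    refine ⟨y.val % p, Finset.mem_range.2 (Nat.mod_lt _ hp.pos), ?_⟩
    have : ((p * (y.val % p) : ℕ) : ZMod (p ^ 2)) = ((p * y.val : ℕ) : ZMod (p ^ 2)) := by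
      rw [ZMod.natCast_eq_natCast_iff]
      have h := Nat.ModEq.mul_left' p (Nat.mod_modEq y.val p)
      have h2 : p ^ 2 = p * p := pow_two p
      generalize y.val = v at h ⊢
      rw [h2]
      exact h
    rw [this]
    push_cast
    rw [ZMod.natCast_zmod_val]

theorem card_Eis (n p : ℕ) [NeZero (p ^ 2)] (hn : 2 ≤ n) (hp : p.Prime) :
    (Finset.univ.filter (fun a : Fin (n + 1) → ZMod (p ^ 2) => Eis n (p : ZMod (p ^ 2)) a)).card
      = (p - 1) ^ 2 * p ^ n := by
  have hpi : (p : ZMod (p ^ 2)) ^ 2 = 0 := by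
    have := ZMod.natCast_self (p ^ 2)
    push_cast at this
    exact this
  obtain ⟨m, rfl⟩ : ∃ m, n = m + 1 := ⟨n - 1, by omega⟩
  set D : Finset (ZMod (p ^ 2)) := Finset.univ.filter (fun x => (p : ZMod (p ^ 2)) ∣ x) with hD
  have hDc : D.card = p := card_dvd p hp
  set F : Fin (m + 1 + 1) → Finset (ZMod (p ^ 2)) := fun j =>
    if j = 0 then D.erase 0 else if j = Fin.last _ then Dᶜ else D with hF
  have : (Finset.univ.filter (fun a : Fin (m + 1 + 1) → ZMod (p ^ 2) =>
      Eis (m + 1) (p : ZMod (p ^ 2)) a)) = Fintype.piFinset F := by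
    ext a
    simp only [Finset.mem_filter, Finset.mem_univ, true_and, Fintype.mem_piFinset, Eis, hpi,
      zero_dvd_iff]
    constructor
    · rintro ⟨h1, h2, h3⟩ j
      simp only [hF]
      split_ifs with h h'
      · subst h
        simp [hD, h3, h2 0 (Fin.last_pos.ne)]
      · subst h'
        simp [hD, h1]
      · simp [hD, h2 j h']
    · intro h
      refine ⟨?_, ?_, ?_⟩
      · have := h (Fin.last _)
        simpa [hF, hD, Fin.last_pos.ne'] using this
      · intro j hj
        have := h j
        by_cases h0 : j = 0
        · subst h0
          simp [hF, hD] at this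
          exact this.2
        · simpa [hF, hD, h0, hj] using this
      · have := h 0
        simp [hF] at this
        exact this.1
  rw [this, Fintype.card_piFinset, Fin.prod_univ_succ, Fin.prod_univ_castSucc]
  have e0 : (F 0).card = p - 1 := by
    simp only [hF, if_true]
    rw [Finset.card_erase_of_mem (by simp [hD]), hDc]
  have e1 : (F (Fin.last m).succ).card = p ^ 2 - p := by
    have : (Fin.last m).succ = Fin.last (m + 1) := rfl
    simp only [hF, this, Fin.last_pos.ne', if_false, if_true]
    rw [Finset.card_compl, hDc, ZMod.card]
  have e2 : ∀ i : Fin m, (F i.castSucc.succ).card = p := by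
    intro i
    have h1 : i.castSucc.succ ≠ 0 := Fin.succ_ne_zero _
    have h2 : i.castSucc.succ ≠ Fin.last (m + 1) := by
      intro h
      have := congrArg Fin.val h
      simp at this
      have := i.2
      omega
    simp only [hF, h1, h2, if_false, hDc]
  rw [e0, e1, Finset.prod_congr rfl (fun i _ => e2 i)]
  simp only [Finset.prod_const, Finset.card_univ, Fintype.card_fin]
  have : p ^ 2 - p = p * (p - 1) := by rw [Nat.mul_sub]; ring_nf
  rw [this]
  ring

theorem card_SP (n p : ℕ) [NeZero (p ^ 2)] (hn : 2 ≤ n) (hp : p.Prime) :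
    (Finset.univ.filter (fun a : Fin (n + 1) → ZMod (p ^ 2) => a ∈ SP n p)).card
      = (p - 1) ^ 2 * p ^ (n + 1) := by
  have hc := card_Eis n p hn hp
  set E := (Finset.univ.filter (fun a : Fin (n + 1) → ZMod (p ^ 2) =>
    Eis n (p : ZMod (p ^ 2)) a)) with hE
  have : (Finset.univ.filter (fun a : Fin (n + 1) → ZMod (p ^ 2) => a ∈ SP n p)).card
      = (Finset.range p ×ˢ E).card := by
    symm
    apply Finset.card_bij (fun (x : ℕ × (Fin (n + 1) → ZMod (p ^ 2))) _ =>
      sh n (-(x.1 : ZMod (p ^ 2))) x.2)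
    · rintro ⟨k, e⟩ h
      simp only [Finset.mem_product, hE, Finset.mem_filter, Finset.mem_univ, true_and] at h ⊢
      refine ⟨k, ?_⟩
      rw [sh_sh]
      simpa [sh_zero] using h.2
    · rintro ⟨k, e⟩ h ⟨l, f⟩ h' heq
      simp only [Finset.mem_product, hE, Finset.mem_filter, Finset.mem_univ, true_and,
        Finset.mem_range] at h h' heq
      have h1 : sh n (((l : ℤ) - k : ℤ) : ZMod (p ^ 2)) e = f := by
        have := congrArg (sh n (l : ZMod (p ^ 2))) heq
        rw [sh_sh, sh_sh, add_neg_cancel, sh_zero] at this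
        rw [← this]
        congr 1
        push_cast
        ring
      have h2 := sh_mod n _ e h.2.2.1 (((l : ℤ) - k : ℤ) : ZMod (p ^ 2)) 0
      rw [h1] at h2
      have h3 : (p : ZMod (p ^ 2)) ∣ f 0 := h'.2.2.1 0 (by
        intro h; have := congrArg Fin.val h; simp at this; omega)
      have h4 := (dvd_sub_right h3).1 h2
      have h5 : (p : ZMod (p ^ 2)) ∣ (((l : ℤ) - k : ℤ) : ZMod (p ^ 2)) := by
        have hp1 : ∀ x y : ZMod (p ^ 2), (p : ZMod (p ^ 2)) ∣ x * y → (p : ZMod (p ^ 2)) ∣ x ∨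
            (p : ZMod (p ^ 2)) ∣ y := by
          intro x y hxy
          obtain ⟨x, rfl⟩ := ZMod.intCast_surjective x
          obtain ⟨y, rfl⟩ := ZMod.intCast_surjective y
          have key := dvd_cast_iff p
          rw [← Int.cast_mul, key] at hxy
          rw [key, key]
          exact (Nat.prime_iff_prime_int.1 hp).dvd_or_dvd hxy
        have hpow : ∀ (x : ZMod (p ^ 2)) (m : ℕ), (p : ZMod (p ^ 2)) ∣ x ^ (m + 1) →
            (p : ZMod (p ^ 2)) ∣ x := by
          intro x m
          induction m with
          | zero => intro h; simpa using h
          | succ m ih =>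
            intro h
            rw [pow_succ x] at h
            exact (hp1 _ _ h).elim ih id
        simp only [Fin.val_zero, Nat.sub_zero, Nat.choose_zero_right, Nat.cast_one, mul_one] at h4
        rcases hp1 _ _ h4 with h6 | h6
        · exact absurd h6 h.2.1
        · obtain ⟨m, rfl⟩ : ∃ m, n = m + 1 := ⟨n - 1, by omega⟩
          exact hpow _ m h6
      rw [dvd_cast_iff] at h5
      have hkl : k = l := by
        have := Int.eq_zero_of_abs_lt_dvd h5 (by rw [abs_lt]; omega)
        omega
      subst hkl
      simp only [sub_self, Int.cast_zero, sh_zero] at h1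
      rw [h1]
    · intro a ha
      simp only [Finset.mem_filter, Finset.mem_univ, true_and] at ha
      obtain ⟨r, hr⟩ := ha
      refine ⟨⟨r.val % p, sh n ((r.val % p : ℕ) : ZMod (p ^ 2)) a⟩, ?_, ?_⟩
      · simp only [Finset.mem_product, hE, Finset.mem_filter, Finset.mem_univ, true_and,
          Finset.mem_range]
        refine ⟨Nat.mod_lt _ hp.pos, ?_⟩
        have := Eis_sh_pi n hn (p : ZMod (p ^ 2)) (-((r.val / p : ℕ) : ZMod (p ^ 2))) _ hr
        rw [sh_sh] at this
        convert this using 2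
        have h1 : r = ((p * (r.val / p) + r.val % p : ℕ) : ZMod (p ^ 2)) := by
          rw [Nat.div_add_mod, ZMod.natCast_zmod_val]
        rw [Nat.cast_add, Nat.cast_mul] at h1
        linear_combination (-1 : ZMod (p ^ 2)) * h1
      · simp only [sh_sh, neg_add_cancel, sh_zero]
  rw [this, Finset.card_product, hc, Finset.card_range]
  ring

end ShiftEis

namespace ShiftEis
open Classical

/-- the box -/
noncomputable def box (d B : ℕ) : Finset (Fin d → ℤ) :=
  Fintype.piFinset (fun _ => Finset.Ico (-(B : ℤ)) B)

theorem mem_box (d B : ℕ) (a : Fin d → ℤ) : a ∈ box d B ↔ ∀ j, -(B : ℤ) ≤ a j ∧ a j < B := by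
  simp [box, Fintype.mem_piFinset]

theorem card_box (d B : ℕ) : (box d B).card = (2 * B) ^ d := by
  simp only [box, Fintype.card_piFinset, Int.card_Ico, Finset.prod_const, Finset.card_univ,
    Fintype.card_fin]
  congr 1
  omega

/-- one-dimensional residue count -/
noncomputable def cnt (N B : ℕ) (r : ZMod N) : ℕ :=
  ((Finset.Ico (-(B : ℤ)) B).filter (fun x : ℤ => (x : ZMod N) = r)).card

theorem cnt_bound (N B : ℕ) (hN : 0 < N) (r : ZMod N) :
    (2 * B : ℝ) / N - 1 ≤ cnt N B r ∧ (cnt N B r : ℝ) ≤ (2 * B : ℝ) / N + 1 := by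
  obtain ⟨v, rfl⟩ := ZMod.intCast_surjective r
  have h := Int.Ico_filter_modEq_card (-(B : ℤ)) B (r := (N : ℤ)) (by exact_mod_cast hN) v
  have e : cnt N B (v : ZMod N) = ((Finset.Ico (-(B : ℤ)) B).filter
      (fun x : ℤ => x ≡ v [ZMOD (N : ℤ)])).card := by
    unfold cnt
    congr 1
    ext x
    simp only [Finset.mem_filter, ZMod.intCast_eq_intCast_iff]
  have h' : ((cnt N B (v : ZMod N) : ℤ)) =
      max (⌈(((B : ℤ) : ℚ) - v) / ((N : ℤ) : ℚ)⌉ - ⌈(((-(B : ℤ) : ℤ) : ℚ) - v) / ((N : ℤ) : ℚ)⌉) 0 := by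
    rw [e, ← h]
  set X : ℚ := (((B : ℤ) : ℚ) - v) / ((N : ℤ) : ℚ) with hX
  set Y : ℚ := (((-(B : ℤ) : ℤ) : ℚ) - v) / ((N : ℤ) : ℚ) with hY
  have hN' : (0 : ℚ) < N := by exact_mod_cast hN
  have hXY : X - Y = 2 * B / N := by
    rw [hX, hY]; push_cast; field_simp; ring
  have hle : (0 : ℚ) ≤ 2 * B / N := by positivity
  have hc1 := Int.le_ceil X
  have hc2 := Int.ceil_lt_add_one X
  have hc3 := Int.le_ceil Y
  have hc4 := Int.ceil_lt_add_one Y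
  have hge : 0 ≤ ⌈X⌉ - ⌈Y⌉ := by
    have : ⌈Y⌉ ≤ ⌈X⌉ := Int.ceil_mono (by linarith)
    omega
  rw [max_eq_left hge] at h'
  have hq : ((cnt N B (v : ZMod N) : ℕ) : ℚ) = (⌈X⌉ : ℚ) - ⌈Y⌉ := by exact_mod_cast h'
  have b1 : (2 * B : ℚ) / N - 1 ≤ cnt N B (v : ZMod N) := by rw [hq]; linarith
  have b2 : (cnt N B (v : ZMod N) : ℚ) ≤ (2 * B : ℚ) / N + 1 := by rw [hq]; linarith
  constructor
  · have := (Rat.cast_le (K := ℝ)).2 b1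
    push_cast at this
    exact this
  · have := (Rat.cast_le (K := ℝ)).2 b2
    push_cast at this
    exact this

theorem cnt_tendsto (N : ℕ) (hN : 0 < N) (r : ZMod N) :
    Tendsto (fun B : ℕ => (cnt N B r : ℝ) / (2 * (B : ℝ))) atTop (nhds (1 / N)) := by
  have hN' : (0 : ℝ) < N := by exact_mod_cast hN
  have h0 : Tendsto (fun B : ℕ => 1 / (2 * (B : ℝ))) atTop (nhds 0) := by
    have := (tendsto_one_div_atTop_nhds_zero_nat (𝕜 := ℝ)).const_mul (1 / 2)
    simp only [mul_zero] at this
    refine this.congr (fun B => ?_)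
    rw [one_div_mul_one_div]
  have hl : Tendsto (fun B : ℕ => 1 / (N : ℝ) - 1 / (2 * (B : ℝ))) atTop (nhds (1 / N)) := by
    simpa using (tendsto_const_nhds (x := 1 / (N : ℝ))).sub h0
  have hu : Tendsto (fun B : ℕ => 1 / (N : ℝ) + 1 / (2 * (B : ℝ))) atTop (nhds (1 / N)) := by
    simpa using (tendsto_const_nhds (x := 1 / (N : ℝ))).add h0
  refine tendsto_of_tendsto_of_tendsto_of_le_of_le' hl hu ?_ ?_
  all_goals
    filter_upwards [eventually_gt_atTop 0] with B hB
    have hB' : (0 : ℝ) < B := by exact_mod_cast hB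
    have hb := cnt_bound N B hN r
  · rw [le_div_iff₀ (by positivity)]
    refine le_trans (le_of_eq ?_) hb.1
    field_simp
  · rw [div_le_iff₀ (by positivity)]
    refine le_trans hb.2 (le_of_eq ?_)
    field_simp

theorem card_residue (d N B : ℕ) (r : Fin d → ZMod N) :
    ((box d B).filter (fun a => (fun j => ((a j : ℤ) : ZMod N)) = r)).card = ∏ j, cnt N B (r j) := by
  unfold cnt
  rw [← Fintype.card_piFinset]
  congr 1
  ext a
  simp only [Finset.mem_filter, mem_box, Fintype.mem_piFinset, Finset.mem_Ico, funext_iff]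
  exact forall_and.symm

theorem card_residue_set (d N B : ℕ) [NeZero N] (S : Set (Fin d → ZMod N)) :
    ((box d B).filter (fun a => (fun j => ((a j : ℤ) : ZMod N)) ∈ S)).card
      = ∑ r ∈ Finset.univ.filter (fun r => r ∈ S), ∏ j, cnt N B (r j) := by
  rw [Finset.card_eq_sum_card_fiberwise (f := fun a => (fun j => ((a j : ℤ) : ZMod N)))
    (t := Finset.univ.filter (fun r => r ∈ S))]
  · apply Finset.sum_congr rfl
    intro r hr
    rw [← card_residue, Finset.filter_filter]
    congr 1
    ext a
    simp only [Finset.mem_filter, Finset.mem_univ, true_and] at hr ⊢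
    constructor
    · rintro ⟨h1, h2, h3⟩
      exact ⟨h1, h3⟩
    · rintro ⟨h1, h3⟩
      exact ⟨h1, h3 ▸ hr, h3⟩
  · intro a ha
    simpa using (Finset.mem_filter.1 ha).2

theorem density_residue (d N : ℕ) [NeZero N] (S : Set (Fin d → ZMod N)) :
    Tendsto (fun B : ℕ => (((box d B).filter
      (fun a => (fun j => ((a j : ℤ) : ZMod N)) ∈ S)).card : ℝ) / (2 * (B : ℝ)) ^ d) atTop
      (nhds (((Finset.univ.filter (fun r => r ∈ S)).card : ℝ) / (N : ℝ) ^ d)) := by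
  have h : Tendsto (fun B : ℕ => ∑ r ∈ Finset.univ.filter (fun r => r ∈ S),
      ∏ j, ((cnt N B (r j) : ℝ) / (2 * (B : ℝ)))) atTop
      (nhds (∑ r ∈ Finset.univ.filter (fun r : Fin d → ZMod N => r ∈ S), ∏ _j : Fin d, (1 / (N : ℝ)))) := by
    apply tendsto_finsetSum
    intro r _
    apply tendsto_finsetProd
    intro j _
    exact cnt_tendsto N (NeZero.pos N) (r j)
  convert h using 2
  · rw [card_residue_set]
    push_cast
    rw [Finset.sum_div]
    apply Finset.sum_congr rfl
    intro r _
    rw [Finset.prod_div_distrib]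
    simp
  · simp [div_eq_mul_inv]

/-- the local sets -/
def AP (n p : ℕ) : Set (Fin (n + 1) → ℤ) := {a | ∃ i : ℤ, Eis n (p : ℤ) (sh n i a)}

theorem AP_iff (n p : ℕ) (a : Fin (n + 1) → ℤ) :
    a ∈ AP n p ↔ (fun j => ((a j : ℤ) : ZMod (p ^ 2))) ∈ SP n p := mem_SP n p a

/-- local factor -/
noncomputable def fac (n : ℕ) (p : Nat.Primes) : ℝ := ((p : ℝ) - 1) ^ 2 / (p : ℝ) ^ (n + 1)

theorem density_finite (n : ℕ) (hn : 2 ≤ n) (P : Finset Nat.Primes) :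
    Tendsto (fun B : ℕ => (((box (n + 1) B).filter (fun a => ∀ p ∈ P, a ∉ AP n p)).card : ℝ) /
      (2 * (B : ℝ)) ^ (n + 1)) atTop (nhds (∏ p ∈ P, (1 - fac n p))) := by
  let m : P → ℕ := fun p => ((p : Nat.Primes) : ℕ) ^ 2
  have hm : ∀ p : P, NeZero (m p) := fun p => ⟨pow_ne_zero _ p.1.2.ne_zero⟩
  have hco : Pairwise (Function.onFun Nat.Coprime m) := by
    intro p q hpq
    apply Nat.Coprime.pow
    rw [Nat.coprime_primes p.1.2 q.1.2]
    intro h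
    exact hpq (Subtype.ext (Subtype.ext h))
  let N := ∏ p, m p
  have hN : NeZero N := ⟨Finset.prod_ne_zero_iff.2 (fun p _ => (hm p).out)⟩
  let φ : ZMod N ≃+* ((p : P) → ZMod (m p)) := ZMod.prodEquivPi m hco
  let S : Set (Fin (n + 1) → ZMod N) := {r | ∀ p : P, (fun j => φ (r j) p) ∉ SP n p}
  have hcard : ((Finset.univ.filter (fun r => r ∈ S)).card : ℝ) / (N : ℝ) ^ (n + 1)
      = ∏ p ∈ P, (1 - fac n p) := by
    let T : (p : P) → Finset (Fin (n + 1) → ZMod (m p)) := fun p =>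
      Finset.univ.filter (fun a => a ∉ SP n p)
    have h1 : (Finset.univ.filter (fun r => r ∈ S)).card = (Fintype.piFinset T).card := by
      apply Finset.card_bij (fun r _ => fun p => fun j => φ (r j) p)
      · intro r hr
        simp only [Finset.mem_filter, Finset.mem_univ, true_and] at hr
        rw [Fintype.mem_piFinset]
        intro p
        simp only [T, Finset.mem_filter, Finset.mem_univ, true_and]
        exact hr p
      · intro r _ s _ h
        funext j
        apply φ.injective
        funext p
        exact congrFun (congrFun h p) j
      · intro t ht
        rw [Fintype.mem_piFinset] at ht
        refine ⟨fun j => φ.symm (fun p => t p j), ?_, ?_⟩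
        · simp only [Finset.mem_filter, Finset.mem_univ, true_and, S, Set.mem_ofPred_eq]
          intro p
          have := ht p
          simp only [T, Finset.mem_filter, Finset.mem_univ, true_and] at this
          simpa using this
        · funext p j
          simp
    have h2 : ∀ p : P, ((T p).card : ℝ) / (m p : ℝ) ^ (n + 1) = 1 - fac n p := by
      intro p
      have hp := p.1.2
      have : NeZero (((p : Nat.Primes) : ℕ) ^ 2) := hm p
      have hc := card_SP n p hn hp
      have hs := Finset.card_filter_add_card_filter_not (s := (Finset.univ : Finset (Fin (n + 1) → ZMod (((p : Nat.Primes) : ℕ) ^ 2))))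
        (fun a => a ∈ SP n p)
      rw [hc, Finset.card_univ, Fintype.card_fun, ZMod.card, Fintype.card_fin] at hs
      have hT : ((T p).card : ℝ) = (((p : Nat.Primes) : ℝ) ^ 2) ^ (n + 1) -
          (((p : Nat.Primes) : ℝ) - 1) ^ 2 * ((p : Nat.Primes) : ℝ) ^ (n + 1) := by
        have h1 : 1 ≤ ((p : Nat.Primes) : ℕ) := hp.one_le
        have := congrArg (fun x : ℕ => (x : ℝ)) hs
        push_cast [Nat.cast_sub h1] at this
        rw [← this]
        simp only [T]
        rw [add_sub_cancel_left]
      have hp0 : ((p : Nat.Primes) : ℝ) ≠ 0 := by exact_mod_cast hp.ne_zero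
      rw [hT]
      simp only [m, fac]
      push_cast
      generalize (((p : Nat.Primes) : ℕ) : ℝ) = x at hp0
      have : (x ^ 2) ^ (n + 1) = x ^ (n + 1) * x ^ (n + 1) := by ring
      rw [this]
      field_simp
    rw [h1, Fintype.card_piFinset]
    simp only [N]
    push_cast
    rw [← Finset.prod_pow, ← Finset.prod_div_distrib, Finset.prod_congr rfl (fun p _ => h2 p)]
    exact Finset.prod_coe_sort P (fun p => 1 - fac n p)
  have hd := density_residue (n + 1) N S
  have hφ : ∀ (p : P) (x : ℤ), φ (x : ZMod N) p = (x : ZMod (m p)) := by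
    intro p x
    rw [map_intCast]
    rfl
  refine Tendsto.congr (fun B => ?_) (Tendsto.mono_right hd (le_of_eq (congrArg nhds ?_)))
  · congr 3
    ext a
    simp only [S, Set.mem_ofPred_eq, hφ, Subtype.forall, AP_iff]
  · rw [← hcard]
    congr!

end ShiftEis

namespace ShiftEis
open Classical

theorem AP_mod (n p : ℕ) (a : Fin (n + 1) → ℤ) (h : a ∈ AP n p) :
    ∃ t : ℤ, ¬ (p : ℤ) ∣ a (Fin.last n) ∧
      ∀ j : Fin (n + 1), (p : ℤ) ∣ a j - a (Fin.last n) * t ^ (n - (j : ℕ)) * (n.choose j : ℤ) := by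
  obtain ⟨i, h1, h2, -⟩ := h
  have hm := sh_mod n (p : ℤ) _ h2 (-i)
  simp only [sh_sh, neg_add_cancel, sh_zero] at hm
  have hl := hm (Fin.last n)
  simp only [Fin.val_last, Nat.sub_self, pow_zero, mul_one, Nat.choose_self, Nat.cast_one] at hl
  refine ⟨-i, fun hd => h1 ((dvd_sub_right hd).1 hl), fun j => ?_⟩
  have := hm j
  obtain ⟨u, hu⟩ := hl
  obtain ⟨v, hv⟩ := this
  exact ⟨v - u * (-i) ^ (n - (j : ℕ)) * (n.choose j : ℤ), by linear_combination hv - (-i) ^ (n - (j : ℕ)) * (n.choose j : ℤ) * hu⟩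

theorem mid_bound (n p B : ℕ) (hn : 1 ≤ n) (hp : p.Prime) (hpB : p ≤ 2 * B) :
    (((box (n + 1) B).filter (fun a => a ∈ AP n p)).card : ℝ) ≤
      (2 * (B : ℝ)) ^ (n + 1) * (2 ^ (n + 1) * (1 / (p : ℝ) ^ (n - 1))) := by
  have : NeZero p := ⟨hp.ne_zero⟩
  let F : ZMod p × ZMod p → (Fin (n + 1) → ZMod p) := fun x j =>
    x.1 * x.2 ^ (n - (j : ℕ)) * (n.choose j : ZMod p)
  obtain ⟨S, hSF⟩ : ∃ S : Set (Fin (n + 1) → ZMod p), S = Set.range F := ⟨_, rfl⟩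
  have h1 : ((box (n + 1) B).filter (fun a => a ∈ AP n p)).card ≤
      ((box (n + 1) B).filter (fun a => (fun j => ((a j : ℤ) : ZMod p)) ∈ S)).card := by
    apply Finset.card_le_card
    intro a ha
    rw [Finset.mem_filter] at ha ⊢
    refine ⟨ha.1, ?_⟩
    obtain ⟨t, -, ht⟩ := AP_mod n p a ha.2
    rw [hSF]
    refine ⟨⟨(a (Fin.last n) : ZMod p), (t : ZMod p)⟩, ?_⟩
    funext j
    have := (ZMod.intCast_zmod_eq_zero_iff_dvd _ p).2 (ht j)
    push_cast at this
    exact (sub_eq_zero.1 this).symm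
  rw [card_residue_set] at h1
  have hp0 : (0 : ℝ) < p := by exact_mod_cast hp.pos
  have h2 : ((∑ r ∈ Finset.univ.filter (fun r => r ∈ S), ∏ j, cnt p B (r j) : ℕ) : ℝ) ≤
      (p : ℝ) ^ 2 * (2 * (2 * (B : ℝ)) / p) ^ (n + 1) := by
    push_cast
    have hS : (Finset.univ.filter (fun r => r ∈ S)).card ≤ p ^ 2 := by
      have : Finset.univ.filter (fun r => r ∈ S) = Finset.univ.image F := by
        ext r; simp [hSF]
      rw [this]
      refine Finset.card_image_le.trans ?_
      simp [ZMod.card, pow_two]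
    have hterm : ∀ r ∈ Finset.univ.filter (fun r => r ∈ S), ∏ j, (cnt p B (r j) : ℝ) ≤
        (2 * (2 * (B : ℝ)) / p) ^ (n + 1) := by
      intro r _
      calc ∏ j, (cnt p B (r j) : ℝ) ≤ ∏ _j : Fin (n + 1), (2 * (2 * (B : ℝ)) / p) := by
            apply Finset.prod_le_prod
            · intros; positivity
            · intro j _
              refine (cnt_bound p B hp.pos (r j)).2.trans ?_
              have : (1 : ℝ) ≤ 2 * B / p := by
                rw [le_div_iff₀ hp0, one_mul]; exact_mod_cast hpB
              have e : 2 * (2 * (B : ℝ)) / p = 2 * B / p + 2 * B / p := by ring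
              rw [e]; linarith
        _ = _ := by simp only [Finset.prod_const, Finset.card_univ, Fintype.card_fin]
    refine (Finset.sum_le_card_nsmul _ _ _ hterm).trans ?_
    rw [nsmul_eq_mul]
    gcongr
    exact_mod_cast hS
  have h3 := (Nat.cast_le (α := ℝ)).2 h1
  refine h3.trans (h2.trans (le_of_eq ?_))
  obtain ⟨m, rfl⟩ : ∃ m, n = m + 1 := ⟨n - 1, by omega⟩
  rw [Nat.add_sub_cancel, div_pow, mul_pow]
  field_simp
  ring

theorem fibre_bound (d B K : ℕ) (k : Fin (d + 1)) (Y : Finset (Fin (d + 1) → ℤ))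
    (hY : Y ⊆ box (d + 1) B)
    (h : ∀ Z ⊆ Y, (∀ a ∈ Z, ∀ b ∈ Z, ∀ j, j ≠ k → a j = b j) → Z.card ≤ K) :
    Y.card ≤ K * (2 * B) ^ d := by
  let f : (Fin (d + 1) → ℤ) → (Fin d → ℤ) := fun a j => a (k.succAbove j)
  have h1 : Y.card ≤ K * (Y.image f).card := by
    apply Finset.card_le_mul_card_image
    intro b _
    apply h _ (Finset.filter_subset _ _)
    intro x hx y hy j hj
    have hx' := (Finset.mem_filter.1 hx).2
    have hy' := (Finset.mem_filter.1 hy).2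
    obtain ⟨i, rfl⟩ := Fin.exists_succAbove_eq hj
    exact congrFun (hx'.trans hy'.symm) i
  refine h1.trans (Nat.mul_le_mul_left _ ?_)
  rw [← card_box]
  apply Finset.card_le_card
  intro b hb
  obtain ⟨a, ha, rfl⟩ := Finset.mem_image.1 hb
  rw [mem_box]
  intro j
  exact (mem_box _ _ _).1 (hY ha) _

theorem card_big_primes (g B : ℕ) (hB : 1 ≤ B) (hg : g ≠ 0) (hlt : g < (2 * B) ^ 3) :
    (g.primeFactors.filter (fun p => 2 * B < p)).card ≤ 2 := by
  set Q := g.primeFactors.filter (fun p => 2 * B < p) with hQ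
  have h1 : (2 * B) ^ Q.card ≤ ∏ p ∈ Q, p :=
    Finset.pow_card_le_prod Q (fun p => p) (2 * B) (fun p hp => (Finset.mem_filter.1 hp).2.le)
  have h2 : ∏ p ∈ Q, p ≤ g := by
    apply Nat.le_of_dvd (Nat.pos_of_ne_zero hg)
    exact (Finset.prod_dvd_prod_of_subset _ _ _ (Finset.filter_subset _ _)).trans
      (Nat.prod_primeFactors_dvd g)
  have h3 := (h1.trans h2).trans_lt hlt
  have := (Nat.pow_lt_pow_iff_right (by omega)).1 h3
  omega

theorem large_bound (n B : ℕ) (hn : 3 ≤ n) (hB : 3 * n ≤ 2 * B) :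
    ((box (n + 1) B).filter (fun a => ∃ p : ℕ, p.Prime ∧ 2 * B < p ∧ a ∈ AP n p)).card ≤
      3 * (2 * B) ^ n := by
  obtain ⟨m, rfl⟩ : ∃ m, n = m + 3 := ⟨n - 3, by omega⟩
  let i0 : Fin (m + 3 + 1) := Fin.last _
  let i1 : Fin (m + 3 + 1) := ⟨m + 2, by omega⟩
  let i2 : Fin (m + 3 + 1) := ⟨m + 1, by omega⟩
  let i3 : Fin (m + 3 + 1) := ⟨m, by omega⟩
  have n02 : i0 ≠ i2 := by simp [i0, i2, Fin.ext_iff]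
  have n12 : i1 ≠ i2 := by simp [i1, i2, Fin.ext_iff]
  have n03 : i0 ≠ i3 := by simp [i0, i3, Fin.ext_iff]
  have n13 : i1 ≠ i3 := by simp [i1, i3, Fin.ext_iff]
  have n23 : i2 ≠ i3 := by simp [i2, i3, Fin.ext_iff]
  let G : (Fin (m + 3 + 1) → ℤ) → ℤ := fun a =>
    ((m : ℤ) + 2) * a i1 ^ 2 - 2 * ((m : ℤ) + 3) * a i0 * a i2
  let H : (Fin (m + 3 + 1) → ℤ) → ℤ := fun a =>
    ((m : ℤ) + 1) * a i1 * a i2 - 3 * ((m : ℤ) + 3) * a i0 * a i3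
  have key : ∀ (p : ℕ) a, a ∈ AP (m + 3) p → ¬ (p : ℤ) ∣ a i0 ∧ (p : ℤ) ∣ G a ∧ (p : ℤ) ∣ H a := by
    intro p a ha
    obtain ⟨t, h0, ht⟩ := AP_mod _ p a ha
    obtain ⟨u1, h1⟩ := ht i1
    obtain ⟨u2, h2⟩ := ht i2
    obtain ⟨u3, h3⟩ := ht i3
    have c1 : (m + 3).choose (m + 2) = m + 3 := by
      rw [← Nat.choose_symm_of_eq_add (show m + 3 = 1 + (m + 2) by ring), Nat.choose_one_right]
    have c2 : (m + 3).choose (m + 1) = (m + 3).choose 2 :=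
      (Nat.choose_symm_of_eq_add (show m + 3 = 2 + (m + 1) by ring)).symm
    have c3 : (m + 3).choose m = (m + 3).choose 3 :=
      (Nat.choose_symm_of_eq_add (show m + 3 = 3 + m by ring)).symm
    have d2 : (m + 3).choose 2 * 2 = (m + 3) * (m + 2) := by
      have := Nat.choose_succ_right_eq (m + 3) 1
      rwa [Nat.choose_one_right, show m + 3 - 1 = m + 2 by omega] at this
    have d3 : (m + 3).choose 3 * 3 = (m + 3).choose 2 * (m + 1) := by
      have := Nat.choose_succ_right_eq (m + 3) 2
      rwa [show m + 3 - 2 = m + 1 by omega] at this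
    simp only [i1, i2, i3, c1, c2, c3, show m + 3 - (m + 2) = 1 by omega,
      show m + 3 - (m + 1) = 2 by omega, show m + 3 - m = 3 by omega] at h1 h2 h3
    have d2' : ((m + 3).choose 2 : ℤ) * 2 = (m + 3) * (m + 2) := by exact_mod_cast d2
    have d3' : ((m + 3).choose 3 : ℤ) * 3 = (m + 3).choose 2 * (m + 1) := by exact_mod_cast d3
    generalize ((m + 3).choose 2 : ℤ) = K2 at *
    generalize ((m + 3).choose 3 : ℤ) = K3 at *
    push_cast at h1
    refine ⟨h0, ?_, ?_⟩
    · change (p : ℤ) ∣ ((m : ℤ) + 2) * a ⟨m + 2, _⟩ ^ 2 -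
        2 * ((m : ℤ) + 3) * a (Fin.last _) * a ⟨m + 1, _⟩
      rw [sub_eq_iff_eq_add] at h1 h2
      rw [h1, h2]
      generalize a (Fin.last (m + 3)) = c
      refine ⟨((m : ℤ) + 2) * u1 * (p * u1 + 2 * (c * t ^ 1 * (m + 3))) -
        2 * ((m : ℤ) + 3) * c * u2, ?_⟩
      linear_combination (- ((m : ℤ) + 3) * c ^ 2 * t ^ 2) * d2'
    · change (p : ℤ) ∣ ((m : ℤ) + 1) * a ⟨m + 2, _⟩ * a ⟨m + 1, _⟩ -
        3 * ((m : ℤ) + 3) * a (Fin.last _) * a ⟨m, _⟩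
      rw [sub_eq_iff_eq_add] at h1 h2 h3
      rw [h1, h2, h3]
      generalize a (Fin.last (m + 3)) = c
      refine ⟨((m : ℤ) + 1) * (u1 * (p * u2 + c * t ^ 2 * K2) + c * t * (m + 3) * u2) -
        3 * ((m : ℤ) + 3) * c * u3, ?_⟩
      linear_combination (- ((m : ℤ) + 3) * c ^ 2 * t ^ 3) * d3'
  set Y := (box (m + 3 + 1) B).filter (fun a => ∃ p : ℕ, p.Prime ∧ 2 * B < p ∧ a ∈ AP (m + 3) p)
    with hY
  have hYb : Y ⊆ box (m + 3 + 1) B := Finset.filter_subset _ _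
  have y1 : (Y.filter (fun a => G a = 0)).card ≤ 1 * (2 * B) ^ (m + 3) := by
    apply fibre_bound _ _ _ i2 _ ((Finset.filter_subset _ _).trans hYb)
    intro Z hZ hag
    rw [Finset.card_le_one]
    intro a ha b hb
    have ha' := Finset.mem_filter.1 (hZ ha)
    have hb' := Finset.mem_filter.1 (hZ hb)
    obtain ⟨p, hp, hpB, hap⟩ := (Finset.mem_filter.1 ha'.1).2
    have h0 := (key p a hap).1
    have h0' : a i0 ≠ 0 := fun h => h0 (h ▸ dvd_zero _)
    funext j
    by_cases hj : j = i2
    · subst hj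
      have e1 := hag a ha b hb i1 n12
      have e0 := hag a ha b hb i0 n02
      have ga := ha'.2
      have gb := hb'.2
      simp only [G] at ga gb
      rw [← e0, ← e1] at gb
      have hm3 : (2 * ((m : ℤ) + 3) * a i0) ≠ 0 := by
        apply mul_ne_zero _ h0'
        positivity
      apply mul_left_cancel₀ hm3
      linarith
    · exact hag a ha b hb j hj
  have y2 : (Y.filter (fun a => ¬ G a = 0)).card ≤ 2 * (2 * B) ^ (m + 3) := by
    apply fibre_bound _ _ _ i3 _ ((Finset.filter_subset _ _).trans hYb)
    intro Z hZ hag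
    rcases Z.eq_empty_or_nonempty with rfl | ⟨a0, ha0⟩
    · simp
    have hGc : ∀ a ∈ Z, G a = G a0 := by
      intro a ha
      simp only [G]
      rw [hag a ha a0 ha0 i0 n03, hag a ha a0 ha0 i1 n13, hag a ha a0 ha0 i2 n23]
    have hG0 : G a0 ≠ 0 := (Finset.mem_filter.1 (hZ ha0)).2
    have hGlt : (G a0).natAbs < (2 * B) ^ 3 := by
      have hb := (mem_box _ _ _).1 (hYb (Finset.mem_filter.1 (hZ ha0)).1)
      have b0 : |a0 i0| ≤ B := by rw [abs_le]; have := hb i0; omega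
      have b1 : |a0 i1| ≤ B := by rw [abs_le]; have := hb i1; omega
      have b2 : |a0 i2| ≤ B := by rw [abs_le]; have := hb i2; omega
      have hB0 : (0 : ℤ) ≤ B := by positivity
      have hGl : |G a0| ≤ ((m : ℤ) + 2) * (B : ℤ) ^ 2 + 2 * ((m : ℤ) + 3) * B * B := by
        refine (abs_sub _ _).trans ?_
        rw [abs_mul, abs_mul, abs_mul, abs_pow, abs_of_nonneg (show (0 : ℤ) ≤ (m : ℤ) + 2 by positivity),
          abs_of_nonneg (show (0 : ℤ) ≤ 2 * ((m : ℤ) + 3) by positivity)]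
        gcongr
      have hlt : ((m : ℤ) + 2) * (B : ℤ) ^ 2 + 2 * ((m : ℤ) + 3) * B * B < (2 * B) ^ 3 := by
        have hB2 : (0 : ℤ) < (B : ℤ) ^ 2 := by
          have : 0 < B := by omega
          positivity
        have : (3 * (m : ℤ) + 8) < 8 * B := by omega
        nlinarith
      have := hGl.trans_lt hlt
      rw [Int.abs_eq_natAbs] at this
      exact_mod_cast this
    have hQ := card_big_primes (G a0).natAbs B (by omega) (by simpa using hG0) hGlt
    refine le_trans ?_ hQ
    have hch : ∀ a ∈ Z, ∃ p : ℕ, p.Prime ∧ 2 * B < p ∧ a ∈ AP (m + 3) p := fun a ha =>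
      (Finset.mem_filter.1 (Finset.mem_filter.1 (hZ ha)).1).2
    choose! q hq using hch
    apply Finset.card_le_card_of_injOn q
    · intro a ha
      obtain ⟨hp, hpB, hap⟩ := hq a ha
      have hd := (key _ a hap).2.1
      rw [hGc a ha] at hd
      simp only [Finset.coe_filter, Nat.mem_primeFactors]
      refine ⟨⟨hp, Int.natCast_dvd.1 hd, by simpa using hG0⟩, hpB⟩
    · intro a ha b hb hab
      obtain ⟨hp, hpB, hap⟩ := hq a ha
      obtain ⟨-, -, hbp⟩ := hq b hb
      rw [← hab] at hbp
      have ka := key _ a hap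
      have kb := key _ b hbp
      have hd := dvd_sub kb.2.2 ka.2.2
      have e : H b - H a = 3 * ((m : ℤ) + 3) * a i0 * (a i3 - b i3) := by
        simp only [H]
        rw [hag a ha b hb i0 n03, hag a ha b hb i1 n13, hag a ha b hb i2 n23]
        ring
      rw [e] at hd
      have hpi := Nat.prime_iff_prime_int.1 hp
      have hd2 : (q a : ℤ) ∣ a i3 - b i3 := by
        rcases hpi.dvd_or_dvd hd with h | h
        · rcases hpi.dvd_or_dvd h with h' | h'
          · exfalso
            have := Int.le_of_dvd (by positivity) h'
            omega
          · exact absurd h' ka.1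
        · exact h
      have ba := (mem_box _ _ _).1 (hYb (Finset.mem_filter.1 (hZ ha)).1) i3
      have bb := (mem_box _ _ _).1 (hYb (Finset.mem_filter.1 (hZ hb)).1) i3
      have := Int.eq_zero_of_abs_lt_dvd hd2 (by rw [abs_lt]; omega)
      funext j
      by_cases hj : j = i3
      · subst hj; omega
      · exact hag a ha b hb j hj
  have := Finset.card_filter_add_card_filter_not (s := Y) (fun a => G a = 0)
  omega

end ShiftEis

namespace ShiftEis
open Classical

theorem summable_primes (n : ℕ) (hn : 3 ≤ n) :
    Summable (fun p : Nat.Primes => 1 / ((p : ℕ) : ℝ) ^ (n - 1)) :=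
  (Real.summable_one_div_nat_pow.2 (show 1 < n - 1 by omega)).comp_injective
    Nat.Primes.coe_nat_injective

theorem fac_bound (n : ℕ) (hn : 3 ≤ n) (p : Nat.Primes) :
    0 ≤ fac n p ∧ fac n p ≤ 1 / ((p : ℕ) : ℝ) ^ (n - 1) := by
  have hp : (1 : ℝ) ≤ ((p : ℕ) : ℝ) := by exact_mod_cast p.2.one_le
  unfold fac
  obtain ⟨m, rfl⟩ : ∃ m, n = m + 1 := ⟨n - 1, by omega⟩
  generalize ((p : ℕ) : ℝ) = x at hp
  refine ⟨by positivity, ?_⟩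
  rw [Nat.add_sub_cancel, div_le_div_iff₀ (by positivity) (by positivity)]
  have : (x - 1) ^ 2 ≤ x ^ 2 := by nlinarith
  calc (x - 1) ^ 2 * x ^ m ≤ x ^ 2 * x ^ m := by gcongr
    _ = 1 * x ^ (m + 1 + 1) := by ring

theorem hasProd_fac (n : ℕ) (hn : 3 ≤ n) :
    HasProd (fun p : Nat.Primes => 1 - fac n p) (∏' p : Nat.Primes, (1 - fac n p)) := by
  have hs : Summable (fun p => fac n p) :=
    Summable.of_nonneg_of_le (fun p => (fac_bound n hn p).1) (fun p => (fac_bound n hn p).2)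
      (summable_primes n hn)
  have := Real.multipliable_one_add_of_summable hs.neg
  simp only [← sub_eq_add_neg] at this
  exact this.hasProd

/-- the target set -/
noncomputable def U (n B : ℕ) : Finset (Fin (n + 1) → ℤ) :=
  (box (n + 1) B).filter (fun a => ∃ p : ℕ, p.Prime ∧ a ∈ AP n p)

/-- avoiding finitely many primes -/
noncomputable def V (n B : ℕ) (P : Finset Nat.Primes) : Finset (Fin (n + 1) → ℤ) :=
  (box (n + 1) B).filter (fun a => ∀ p ∈ P, a ∉ AP n p)

theorem lower (n B : ℕ) (P : Finset Nat.Primes) :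
    (2 * B) ^ (n + 1) ≤ (U n B).card + (V n B P).card := by
  rw [← card_box]
  refine le_trans (Finset.card_le_card ?_) (Finset.card_union_le _ _)
  intro a ha
  simp only [U, V, Finset.mem_union, Finset.mem_filter]
  by_cases h : ∀ p ∈ P, a ∉ AP n p
  · exact Or.inr ⟨ha, h⟩
  · push Not at h
    obtain ⟨p, -, hp⟩ := h
    exact Or.inl ⟨ha, p, p.2, hp⟩

theorem upper (n B : ℕ) (hn : 3 ≤ n) (hB : 3 * n ≤ 2 * B) (P : Finset Nat.Primes) :
    ∃ T : Finset Nat.Primes, Disjoint T P ∧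
      ((U n B).card : ℝ) + (V n B P).card ≤ (2 * (B : ℝ)) ^ (n + 1) +
        (2 * (B : ℝ)) ^ (n + 1) * (2 ^ (n + 1) * ∑ p ∈ T, 1 / ((p : ℕ) : ℝ) ^ (n - 1)) +
        3 * (2 * (B : ℝ)) ^ n := by
  have hfin : Set.Finite {p : Nat.Primes | (p : ℕ) ≤ 2 * B} :=
    Set.Finite.preimage (Nat.Primes.coe_nat_injective.injOn) (Set.finite_Iic (2 * B))
  let T := hfin.toFinset \ P
  refine ⟨T, Finset.sdiff_disjoint, ?_⟩
  have hsub : U n B ⊆ ((box (n + 1) B \ V n B P) ∪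
      T.biUnion (fun p => (box (n + 1) B).filter (fun a => a ∈ AP n p))) ∪
      (box (n + 1) B).filter (fun a => ∃ p : ℕ, p.Prime ∧ 2 * B < p ∧ a ∈ AP n p) := by
    intro a ha
    simp only [U, Finset.mem_filter] at ha
    obtain ⟨hb, p, hp, hap⟩ := ha
    simp only [Finset.mem_union, Finset.mem_sdiff, Finset.mem_biUnion, Finset.mem_filter, V, T]
    by_cases h1 : 2 * B < p
    · exact Or.inr ⟨hb, p, hp, h1, hap⟩
    left
    by_cases h2 : (⟨p, hp⟩ : Nat.Primes) ∈ P
    · left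
      exact ⟨hb, fun h => h.2 _ h2 hap⟩
    · right
      refine ⟨⟨p, hp⟩, ⟨?_, h2⟩, hb, hap⟩
      exact (Set.Finite.mem_toFinset hfin).2 (not_lt.1 h1)
  have hV : V n B P ⊆ box (n + 1) B := Finset.filter_subset _ _
  have hc := (Finset.card_le_card hsub).trans ((Finset.card_union_le _ _).trans
    (Nat.add_le_add_right (Finset.card_union_le _ _) _))
  have hVc := Finset.card_sdiff_add_card_eq_card hV
  rw [card_box] at hVc
  have hL := large_bound n B hn hB
  have hM : ((T.biUnion (fun p => (box (n + 1) B).filter (fun a => a ∈ AP n p))).card : ℝ) ≤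
      (2 * (B : ℝ)) ^ (n + 1) * (2 ^ (n + 1) * ∑ p ∈ T, 1 / ((p : ℕ) : ℝ) ^ (n - 1)) := by
    refine le_trans (Nat.cast_le.2 Finset.card_biUnion_le) ?_
    rw [Nat.cast_sum, Finset.mul_sum, Finset.mul_sum]
    apply Finset.sum_le_sum
    intro p hp
    apply mid_bound n p B (by omega) p.2
    have := (Finset.mem_sdiff.1 hp).1
    rw [Set.Finite.mem_toFinset] at this
    exact this
  have hc' := (Nat.cast_le (α := ℝ)).2 hc
  have hVc' := congrArg (fun x : ℕ => (x : ℝ)) hVc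
  have hL' := (Nat.cast_le (α := ℝ)).2 hL
  push_cast at hc' hVc' hL'
  linarith

theorem main (n : ℕ) (hn : 3 ≤ n) :
    Tendsto (fun B : ℕ => ((U n B).card : ℝ) / (2 * (B : ℝ)) ^ (n + 1)) atTop
      (nhds (1 - ∏' p : Nat.Primes, (1 - fac n p))) := by
  rw [Metric.tendsto_nhds]
  intro ε hε
  have hprod := hasProd_fac n hn
  have hε4 : 0 < ε / 4 := by positivity
  have e1 : ∀ᶠ P : Finset Nat.Primes in atTop,
      dist (∏ p ∈ P, (1 - fac n p)) (∏' p : Nat.Primes, (1 - fac n p)) < ε / 4 := by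
    have h := hprod
    rw [HasProd, SummationFilter.unconditional_filter] at h
    exact (Metric.tendsto_nhds.1 h) _ hε4
  obtain ⟨s, hs⟩ := summable_iff_vanishing_norm.1 ((summable_primes n hn).mul_left (2 ^ (n + 1)))
    (ε / 4) hε4
  obtain ⟨P, hP1, hP2⟩ := (e1.and (eventually_ge_atTop s)).exists
  have e2 := (Metric.tendsto_nhds.1 (density_finite n (by omega) P)) _ hε4
  have e3 : ∀ᶠ B : ℕ in atTop, 3 / (2 * (B : ℝ)) < ε / 4 := by
    have h0 : Tendsto (fun B : ℕ => 3 / (2 * (B : ℝ))) atTop (nhds 0) := by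
      apply Tendsto.div_atTop tendsto_const_nhds
      exact tendsto_natCast_atTop_atTop.const_mul_atTop (by norm_num)
    exact h0.eventually_lt_const hε4
  filter_upwards [e2, e3, eventually_ge_atTop (3 * n)] with B h2 h3 hB
  have hB0 : (0 : ℝ) < B := by
    have : 0 < B := by omega
    exact_mod_cast this
  obtain ⟨T, hT, hup⟩ := upper n B hn (by omega) P
  have hTs := hs T (hT.mono_right hP2)
  rw [← Finset.mul_sum, Real.norm_eq_abs] at hTs
  have hTs' := (abs_lt.1 hTs).2
  have hlo := (Nat.cast_le (α := ℝ)).2 (lower n B P)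
  push_cast at hlo
  change dist (((V n B P).card : ℝ) / _) _ < _ at h2
  have hD : (0 : ℝ) < (2 * (B : ℝ)) ^ (n + 1) := by positivity
  have l1 : 1 ≤ ((U n B).card : ℝ) / (2 * (B : ℝ)) ^ (n + 1) +
      ((V n B P).card : ℝ) / (2 * (B : ℝ)) ^ (n + 1) := by
    rw [← add_div, le_div_iff₀ hD]; linarith
  have l2 : ((U n B).card : ℝ) / (2 * (B : ℝ)) ^ (n + 1) +
      ((V n B P).card : ℝ) / (2 * (B : ℝ)) ^ (n + 1) ≤
      1 + (2 ^ (n + 1) * ∑ p ∈ T, 1 / ((p : ℕ) : ℝ) ^ (n - 1)) + 3 / (2 * (B : ℝ)) := by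
    rw [← add_div, div_le_iff₀ hD]
    refine hup.trans (le_of_eq ?_)
    generalize (2 ^ (n + 1) * ∑ p ∈ T, 1 / ((p : ℕ) : ℝ) ^ (n - 1)) = z
    field_simp
    ring
  rw [Real.dist_eq, abs_lt] at *
  constructor <;> linarith [hP1.1, hP1.2, h2.1, h2.2]

end ShiftEis

/-- For `n ≥ 3`, the natural density of the set of shifted Eisenstein
polynomials of degree `n` (identified with subsets of `ℤ^{n+1}`) exists and
equals `1 - ∏_p (1 - (p-1)²/p^{n+1})`, the product running over all primes. -/
theorem density_shiftedEisenstein (n : ℕ) (hn : 3 ≤ n) :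
    Tendsto (fun B : ℕ =>
      (({a : Fin (n + 1) → ℤ |
          (∃ p : ℕ, p.Prime ∧ ∃ i : ℤ,
            IsEisensteinZ p n ((toPolyZ n a).comp (X + C i))) ∧
          ∀ j, -(B : ℤ) ≤ a j ∧ a j < B}.ncard : ℝ)) / (2 * (B : ℝ)) ^ (n + 1))
      atTop
      (nhds (1 - ∏' q : Nat.Primes, (1 - ((q : ℝ) - 1) ^ 2 / (q : ℝ) ^ (n + 1)))) := by

  classical
  refine (ShiftEis.main n hn).congr (fun B => ?_)
  congr 2
  rw [← Set.ncard_coe_finset]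
  congr 1
  ext a
  rw [Finset.mem_coe, ShiftEis.U, Finset.mem_filter, ShiftEis.mem_box, Set.mem_ofPred_eq]
  simp only [ShiftEis.isEis_iff, ShiftEis.AP, Set.mem_ofPred_eq]
  exact and_comm
end

section
/- The natural density of the set of shifted Eisenstein polynomials of degree 2 (as a subset of ℤ³) exists and equals 1. -/
open Polynomial Filter

def ShiftedEis (a : Fin 3 → ℤ) : Prop :=
  ∃ p : ℕ, p.Prime ∧ ∃ i : ℤ, IsEisensteinZ p 2 ((toPolyZ 2 a).comp (X + C i))

lemma comp_eq (a : Fin 3 → ℤ) (i : ℤ) : (toPolyZ 2 a).comp (X + C i) =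
    C (a 2) * X ^ 2 + C (2 * a 2 * i + a 1) * X + C (a 2 * i ^ 2 + a 1 * i + a 0) := by
  simp [toPolyZ, Fin.sum_univ_three]
  ring

lemma quad_coeff_two (u v w : ℤ) : (C u * X ^ 2 + C v * X + C w : ℤ[X]).coeff 2 = u := by
  simp [coeff_X, coeff_C, -eq_intCast, -map_intCast]

lemma quad_coeff_one (u v w : ℤ) : (C u * X ^ 2 + C v * X + C w : ℤ[X]).coeff 1 = v := by
  simp [coeff_X, coeff_C, coeff_X_pow, -eq_intCast, -map_intCast]

lemma quad_coeff_zero (u v w : ℤ) : (C u * X ^ 2 + C v * X + C w : ℤ[X]).coeff 0 = w := by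
  simp [coeff_X, coeff_C, -eq_intCast, -map_intCast]

lemma shifted_of_disc (p : ℕ) (hp : p.Prime) (hp2 : p ≠ 2) (a : Fin 3 → ℤ)
    (ha : ¬ (p : ℤ) ∣ a 2) (h1 : (p : ℤ) ∣ a 1 ^ 2 - 4 * a 2 * a 0)
    (h2 : ¬ (p : ℤ) ^ 2 ∣ a 1 ^ 2 - 4 * a 2 * a 0) : ShiftedEis a := by
  have hpi : Prime (p : ℤ) := Nat.prime_iff_prime_int.mp hp
  have hn2 : ¬ (p : ℤ) ∣ 2 := by
    intro h
    have : p ∣ 2 := by exact_mod_cast h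
    exact hp2 ((Nat.prime_dvd_prime_iff_eq hp Nat.prime_two).mp this)
  have hn : ¬ (p : ℤ) ∣ 2 * a 2 := fun h => (hpi.dvd_or_dvd h).elim hn2 ha
  have hcop : IsCoprime ((p : ℤ) ^ 2) (2 * a 2) :=
    ((hpi.coprime_iff_not_dvd).mpr hn).pow_left
  obtain ⟨v, u, huv⟩ := hcop
  refine ⟨p, hp, -u * a 1, ?_⟩
  rw [comp_eq]
  have hb : 2 * a 2 * (-u * a 1) + a 1 = a 1 * v * (p : ℤ) ^ 2 := by linear_combination (-a 1) * huv
  set i := -u * a 1 with hi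
  have hf : 4 * a 2 * (a 2 * i ^ 2 + a 1 * i + a 0) =
      (a 1 * v * (p : ℤ) ^ 2) ^ 2 - (a 1 ^ 2 - 4 * a 2 * a 0) := by
    rw [← hb]; ring
  have ha0 : a 2 ≠ 0 := fun h => ha (h ▸ dvd_zero _)
  have hpf : (p : ℤ) ∣ a 2 * i ^ 2 + a 1 * i + a 0 := by
    have : (p : ℤ) ∣ 2 * (2 * a 2) * (a 2 * i ^ 2 + a 1 * i + a 0) := by
      have e : 2 * (2 * a 2) * (a 2 * i ^ 2 + a 1 * i + a 0) =
        (a 1 * v * (p : ℤ) ^ 2) ^ 2 - (a 1 ^ 2 - 4 * a 2 * a 0) := by rw [← hf]; ring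
      rw [e]
      exact dvd_sub ⟨a 1 ^ 2 * v ^ 2 * p ^ 3, by ring⟩ h1
    rcases hpi.dvd_or_dvd this with h | h
    · exact ((hpi.dvd_or_dvd h).elim hn2 hn).elim
    · exact h
  refine ⟨natDegree_quadratic ha0, ?_, ?_, ?_⟩
  · rw [quad_coeff_two]
    exact ha
  · intro k hk
    interval_cases k
    · rw [quad_coeff_zero]
      exact hpf
    · rw [quad_coeff_one, hb]
      exact ⟨a 1 * v * p, by ring⟩
  · rw [quad_coeff_zero]
    intro h
    apply h2
    have e : a 1 ^ 2 - 4 * a 2 * a 0 = (a 1 * v * (p : ℤ) ^ 2) ^ 2 -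
      4 * a 2 * (a 2 * i ^ 2 + a 1 * i + a 0) := by rw [hf]; ring
    rw [e]
    exact dvd_sub ⟨a 1 ^ 2 * v ^ 2 * p ^ 2, by ring⟩ (h.mul_left _)

/-- parametrisation of good residues -/
def goodMap (p : ℕ) (x : (ZMod (p ^ 2))ˣ × ZMod (p ^ 2) × Fin (p - 1)) : Fin 3 → ZMod (p ^ 2) :=
  ![(x.2.1 ^ 2 - (p : ZMod (p ^ 2)) * ((x.2.2 : ℕ) + 1 : ℕ)) * (4 : ZMod (p ^ 2))⁻¹ * (x.1⁻¹ : (ZMod (p ^ 2))ˣ),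
    x.2.1, x.1]

lemma four_inv (p : ℕ) (hp : p.Prime) (hp2 : p ≠ 2) :
    (4 : ZMod (p ^ 2)) * (4 : ZMod (p ^ 2))⁻¹ = 1 := by
  have : Nat.Coprime 4 (p ^ 2) := by
    apply Nat.Coprime.pow_right
    rw [show 4 = 2 ^ 2 by norm_num]
    apply Nat.Coprime.pow_left
    exact (Nat.coprime_primes Nat.prime_two hp).mpr (Ne.symm hp2)
  exact_mod_cast ZMod.coe_mul_inv_eq_one 4 this

lemma goodMap_disc (p : ℕ) (hp : p.Prime) (hp2 : p ≠ 2) (x) :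
    (goodMap p x 1) ^ 2 - 4 * goodMap p x 2 * goodMap p x 0 = ((p * ((x.2.2 : ℕ) + 1) : ℕ) : ZMod (p ^ 2)) := by
  have h4 := four_inv p hp hp2
  have hu : (x.1 : ZMod (p ^ 2)) * (x.1⁻¹ : (ZMod (p ^ 2))ˣ) = 1 := by simp
  simp only [goodMap, Matrix.cons_val]
  push_cast
  set y := (x.2.1 ^ 2 - (p : ZMod (p ^ 2)) * (((x.2.2 : ℕ) : ZMod (p ^ 2)) + 1))
  have : (4 : ZMod (p ^ 2)) * x.1 * (y * (4 : ZMod (p ^ 2))⁻¹ * (x.1⁻¹ : (ZMod (p ^ 2))ˣ)) = y := by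
    linear_combination y * (x.1 : ZMod (p ^ 2)) * (x.1⁻¹ : (ZMod (p ^ 2))ˣ) * h4 + y * hu
  rw [this]
  ring

lemma lt_sq (p : ℕ) (t : Fin (p - 1)) : p * ((t : ℕ) + 1) < p ^ 2 := by
  have := t.2
  rw [pow_two]
  exact Nat.mul_lt_mul_of_pos_left (by omega) (by omega)

lemma goodMap_inj (p : ℕ) (hp : p.Prime) (hp2 : p ≠ 2) : Function.Injective (goodMap p) := by
  intro x y h
  have hd : ((p * ((x.2.2 : ℕ) + 1) : ℕ) : ZMod (p ^ 2)) = ((p * ((y.2.2 : ℕ) + 1) : ℕ) : ZMod (p ^ 2)) := by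
    rw [← goodMap_disc p hp hp2 x, ← goodMap_disc p hp hp2 y, h]
  rw [ZMod.natCast_eq_natCast_iff] at hd
  have h3 := Nat.ModEq.eq_of_lt_of_lt hd (lt_sq p _) (lt_sq p _)
  have h3 := Nat.eq_of_mul_eq_mul_left hp.pos h3
  have h1 := congrFun h 1
  have h2 := congrFun h 2
  simp only [goodMap, Matrix.cons_val] at h1 h2
  refine Prod.ext (Units.ext h2) (Prod.ext h1 (Fin.ext (by omega)))

lemma shifted_of_good (p : ℕ) (hp : p.Prime) (hp2 : p ≠ 2) (a : Fin 3 → ℤ) 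
    (h : (fun j => (a j : ZMod (p ^ 2))) ∈ Set.range (goodMap p)) : ShiftedEis a := by
  obtain ⟨x, hx⟩ := h
  have hd := goodMap_disc p hp hp2 x
  have h2 : ((x.1 : (ZMod (p ^ 2))ˣ) : ZMod (p ^ 2)) = a 2 := by
    simpa [goodMap] using congrFun hx 2
  rw [hx] at hd
  have hd' : ((a 1 ^ 2 - 4 * a 2 * a 0 : ℤ) : ZMod (p ^ 2)) =
     (((p * ((x.2.2 : ℕ) + 1) : ℕ) : ℤ) : ZMod (p ^ 2)) := by
    rw [Int.cast_natCast, ← hd]; push_cast; ring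
  have hdv := (ZMod.intCast_eq_intCast_iff_dvd_sub _ _ _).mp hd'
  rw [Nat.cast_pow] at hdv
  have hlt := lt_sq p x.2.2
  refine shifted_of_disc p hp hp2 a ?_ ?_ ?_
  · intro hdiv
    have hu : IsUnit ((a 2 : ℤ) : ZMod (p ^ 2)) := h2 ▸ x.1.isUnit
    have hc := (ZMod.coe_int_isUnit_iff_isCoprime _ _).mp hu
    have hpi : Prime (p : ℤ) := Nat.prime_iff_prime_int.mp hp
    push_cast at hc
    exact hpi.not_isUnit (hc.isUnit_of_dvd' (dvd_pow_self _ two_ne_zero) hdiv)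
  · have := (dvd_pow_self (p : ℤ) two_ne_zero).trans hdv
    refine (dvd_sub_right (a := (p : ℤ)) (b := ((p * ((x.2.2 : ℕ) + 1) : ℕ) : ℤ)) ?_).mp this
    push_cast
    exact dvd_mul_right _ _
  · intro hh
    have := (dvd_sub_left hh).mp hdv
    have : p ^ 2 ∣ p * ((x.2.2 : ℕ) + 1) := by exact_mod_cast this
    have := Nat.le_of_dvd (Nat.mul_pos hp.pos (by omega)) this
    omega

open Classical in
lemma card_bad (p : ℕ) (hp : p.Prime) (hp2 : p ≠ 2) :
    (Nat.card {w : Fin 3 → ZMod (p ^ 2) // w ∉ Set.range (goodMap p)} : ℝ) ≤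
      ((p ^ 2 : ℕ) : ℝ) ^ 3 * Real.exp (-(4 / 9) * (1 / p)) := by
  haveI : NeZero (p ^ 2) := ⟨pow_ne_zero _ hp.ne_zero⟩
  have h1 : Nat.card (Set.range (goodMap p)) = p * (p - 1) * (p ^ 2 * (p - 1)) := by
    rw [Nat.card_range_of_injective (goodMap_inj p hp hp2)]
    simp [Nat.card_eq_fintype_card, ZMod.card_units_eq_totient, Nat.totient_prime_pow hp]
  have h2 : Nat.card {w : Fin 3 → ZMod (p ^ 2) // w ∉ Set.range (goodMap p)} +
      Nat.card (Set.range (goodMap p)) = (p ^ 2) ^ 3 := by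
    have := Fintype.card_subtype_compl (fun w : Fin 3 → ZMod (p ^ 2) => w ∈ Set.range (goodMap p))
    have h' := Fintype.card_subtype_le (fun w : Fin 3 → ZMod (p ^ 2) => w ∈ Set.range (goodMap p))
    have hc : Fintype.card (Fin 3 → ZMod (p ^ 2)) = (p ^ 2) ^ 3 := by simp [ZMod.card]
    rw [Nat.card_eq_fintype_card, Nat.card_eq_fintype_card]
    rw [hc] at this h'
    have e : Fintype.card (Set.range (goodMap p)) =
      Fintype.card {w : Fin 3 → ZMod (p ^ 2) // w ∈ Set.range (goodMap p)} := by convert rfl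
    omega
  rw [h1] at h2
  have hp3 : 3 ≤ p := by have := hp.two_le; omega
  have h3 : (Nat.card {w : Fin 3 → ZMod (p ^ 2) // w ∉ Set.range (goodMap p)} : ℝ) =
     (p ^ 2) ^ 3 - p * (p - 1) * (p ^ 2 * (p - 1)) := by
    have := congrArg (Nat.cast (R := ℝ)) h2
    push_cast [Nat.cast_sub hp.one_le] at this
    linarith
  rw [h3]
  have hpr : (3 : ℝ) ≤ p := by exact_mod_cast hp3
  have hexp := Real.add_one_le_exp (-(4 / 9) * (1 / (p : ℝ)))
  calc ((p : ℝ) ^ 2) ^ 3 - p * (p - 1) * (p ^ 2 * (p - 1))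
      ≤ ((p : ℝ) ^ 2) ^ 3 * (-(4 / 9) * (1 / (p : ℝ)) + 1) := by
        have : ((p : ℝ) ^ 2) ^ 3 * (-(4 / 9) * (1 / (p : ℝ)) + 1) = p ^ 6 - 4 / 9 * p ^ 5 := by
          field_simp
          ring
        rw [this]
        have hq : 0 ≤ (p : ℝ) ^ 3 * ((p - 1) ^ 2 - 4 / 9 * p ^ 2) := by
          apply mul_nonneg (by positivity)
          nlinarith
        nlinarith
    _ ≤ _ := by
        push_cast
        gcongr

lemma card_residue (B N : ℕ) (hN : 0 < N) (r : ZMod N) :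
    ((((Finset.Ico (-(B : ℤ)) B).filter (fun x : ℤ => (x : ZMod N) = r)).card : ℕ) : ℝ) ≤
      2 * B / N + 1 := by
  obtain ⟨v, rfl⟩ := ZMod.intCast_surjective r
  have hN' : (0 : ℤ) < N := by exact_mod_cast hN
  have h := Int.Ico_filter_modEq_card (-(B : ℤ)) B hN' v
  simp_rw [ZMod.intCast_eq_intCast_iff]
  have h' := congrArg (Int.cast (R := ℝ)) h
  rw [Int.cast_natCast] at h'
  rw [h']
  have hNr : (0 : ℝ) < N := by exact_mod_cast hN
  rw [Int.cast_max]
  apply max_le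
  · have e1 := Int.ceil_lt_add_one ((((B : ℤ) - v : ℤ) : ℚ) / ((N : ℤ) : ℚ))
    have e2 := Int.le_ceil (((-(B : ℤ) - v : ℤ) : ℚ) / ((N : ℤ) : ℚ))
    have e3 : ((⌈(((B : ℤ) - v : ℤ) : ℚ) / ((N : ℤ) : ℚ)⌉ - ⌈((-(B : ℤ) - v : ℤ) : ℚ) / ((N : ℤ) : ℚ)⌉ : ℤ) : ℚ) ≤ 2 * B / N + 1 := by
      have : (2 * B / N : ℚ) = (((B : ℤ) - v : ℤ) : ℚ) / ((N : ℤ) : ℚ) - ((-(B : ℤ) - v : ℤ) : ℚ) / ((N : ℤ) : ℚ) := by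
        push_cast; ring
      rw [this]; push_cast at *; linarith
    have := (Rat.cast_le (K := ℝ)).mpr e3
    push_cast at *
    convert this using 2
  · push_cast; positivity

noncomputable def box (B : ℕ) : Finset (Fin 3 → ℤ) := Fintype.piFinset (fun _ => Finset.Ico (-(B : ℤ)) B)

lemma card_box (B : ℕ) : (box B).card = (2 * B) ^ 3 := by
  simp [box]
  omega

open Classical in
lemma card_box_filter (B N : ℕ) (hN : 0 < N) (W : Finset (Fin 3 → ZMod N)) :
    (((box B).filter (fun a => (fun j => (a j : ZMod N)) ∈ W)).card : ℝ) ≤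
      W.card * (2 * B / N + 1) ^ 3 := by
  have hsub : (box B).filter (fun a => (fun j => (a j : ZMod N)) ∈ W) ⊆
      W.biUnion (fun w => Fintype.piFinset
        (fun j => (Finset.Ico (-(B : ℤ)) B).filter (fun x : ℤ => (x : ZMod N) = w j))) := by
    intro a ha
    simp only [Finset.mem_filter, box, Fintype.mem_piFinset, Finset.mem_biUnion] at *
    exact ⟨_, ha.2, fun j => ⟨ha.1 j, rfl⟩⟩
  have h1 := (Finset.card_le_card hsub).trans Finset.card_biUnion_le
  calc _ ≤ ((∑ w ∈ W, (Fintype.piFinset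
        (fun j : Fin 3 => (Finset.Ico (-(B : ℤ)) B).filter (fun x : ℤ => (x : ZMod N) = w j))).card : ℕ) : ℝ) := by
          exact_mod_cast h1
    _ ≤ ∑ w ∈ W, (2 * B / N + 1 : ℝ) ^ 3 := by
        push_cast
        apply Finset.sum_le_sum
        intro w _
        rw [Fintype.card_piFinset]
        push_cast
        calc _ ≤ ∏ j : Fin 3, (2 * B / N + 1 : ℝ) :=
              Finset.prod_le_prod (fun _ _ => by positivity) (fun j _ => card_residue B N hN _)
          _ = _ := by simp
    _ = _ := by simp

open Classical in
lemma exists_W (S : Finset ℕ) (hS : ∀ p ∈ S, p.Prime ∧ p ≠ 2) :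
    ∃ N : ℕ, 0 < N ∧ ∃ W : Finset (Fin 3 → ZMod N),
      (∀ a : Fin 3 → ℤ, ¬ ShiftedEis a → (fun j => (a j : ZMod N)) ∈ W) ∧
      (W.card : ℝ) ≤ (N : ℝ) ^ 3 * Real.exp (-(4 / 9) * ∑ p ∈ S, (1 / p : ℝ)) := by
  let N := ∏ p : S, (p : ℕ) ^ 2
  have hcop : Pairwise (Function.onFun Nat.Coprime (fun p : S => (p : ℕ) ^ 2)) := by
    intro p q hpq
    apply Nat.Coprime.pow
    exact (Nat.coprime_primes (hS p p.2).1 (hS q q.2).1).mpr (fun h => hpq (Subtype.ext h))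
  have hN : 0 < N := Finset.prod_pos (fun p _ => pow_pos (hS p p.2).1.pos 2)
  haveI : NeZero N := ⟨hN.ne'⟩
  haveI (p : S) : NeZero ((p : ℕ) ^ 2) := ⟨pow_ne_zero _ (hS p p.2).1.ne_zero⟩
  let e : ZMod N ≃+* (∀ p : S, ZMod ((p : ℕ) ^ 2)) := ZMod.prodEquivPi _ hcop
  let P : (Fin 3 → ZMod N) → Prop :=
    fun w => ∀ p : S, (fun j => e (w j) p) ∉ Set.range (goodMap p)
  refine ⟨N, hN, Finset.univ.filter P, ?_, ?_⟩
  · intro a ha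
    rw [Finset.mem_filter]
    refine ⟨Finset.mem_univ _, fun p hp => ha (shifted_of_good p (hS p p.2).1 (hS p p.2).2 a ?_)⟩
    simpa using hp
  · have hinj : Function.Injective (fun (w : {w // P w}) (p : S) =>
        (⟨fun j => e (w.1 j) p, w.2 p⟩ :
          {w : Fin 3 → ZMod ((p : ℕ) ^ 2) // w ∉ Set.range (goodMap p)})) := by
      intro w w' h
      apply Subtype.ext
      funext j
      apply e.injective
      funext p
      exact congrFun (congrArg Subtype.val (congrFun h p)) j
    have hc := Nat.card_le_card_of_injective _ hinj
    rw [Nat.card_pi] at hc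
    have hW : (Finset.univ.filter P).card = Nat.card {w // P w} := by
      rw [Nat.card_eq_fintype_card, Fintype.card_subtype]
    rw [hW]
    calc (Nat.card {w // P w} : ℝ) ≤ ((∏ p : S, Nat.card {w : Fin 3 → ZMod ((p : ℕ) ^ 2) //
            w ∉ Set.range (goodMap p)} : ℕ) : ℝ) := by exact_mod_cast hc
      _ ≤ ∏ p : S, ((((p : ℕ) ^ 2 : ℕ) : ℝ) ^ 3 * Real.exp (-(4 / 9) * (1 / (p : ℕ)))) := by
          push_cast
          apply Finset.prod_le_prod (fun _ _ => by positivity)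
          intro p _
          have := card_bad p (hS p p.2).1 (hS p p.2).2
          push_cast at this
          exact this
      _ = _ := by
          rw [Finset.prod_mul_distrib, Finset.prod_pow, ← Real.exp_sum, ← Finset.mul_sum]
          congr 2
          · simp [N]
          · congr 1
            exact Finset.sum_coe_sort S (fun p : ℕ => (1 / p : ℝ))

lemma exists_S (ε : ℝ) (hε : 0 < ε) : ∃ S : Finset ℕ, (∀ p ∈ S, p.Prime ∧ p ≠ 2) ∧
    Real.exp (-(4 / 9) * ∑ p ∈ S, (1 / p : ℝ)) < ε := by
  have h := not_summable_one_div_on_primes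
  rw [not_summable_iff_tendsto_nat_atTop_of_nonneg] at h
  · obtain ⟨n, hn⟩ := (h.eventually_gt_atTop (9 / 4 * (-Real.log ε) + 1 / 2)).exists
    refine ⟨((Finset.range n).filter Nat.Prime).erase 2, ?_, ?_⟩
    · intro p hp
      simp at hp
      exact ⟨hp.2.2, hp.1⟩
    · rw [← Real.lt_log_iff_exp_lt hε]
      have e : ∑ i ∈ Finset.range n, ({p : ℕ | p.Prime}.indicator (fun n : ℕ => (1 / n : ℝ))) i =
          ∑ p ∈ (Finset.range n).filter Nat.Prime, (1 / p : ℝ) := by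
        rw [Finset.sum_filter]
        simp only [Set.indicator_apply, Set.mem_ofPred_eq]
      have e2 : ∑ p ∈ (Finset.range n).filter Nat.Prime, (1 / p : ℝ) ≤
         ∑ p ∈ ((Finset.range n).filter Nat.Prime).erase 2, (1 / p : ℝ) + 1 / 2 := by
        by_cases h2 : 2 ∈ (Finset.range n).filter Nat.Prime
        · rw [← Finset.sum_erase_add _ _ h2]; norm_num
        · rw [Finset.erase_eq_of_notMem h2]; norm_num
      rw [e] at hn
      linarith
  · intro n
    apply Set.indicator_nonneg
    intros; positivity

theorem density_shiftedEisenstein_degree_two :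
    Tendsto (fun B : ℕ =>
      (({a : Fin 3 → ℤ |
          (∃ p : ℕ, p.Prime ∧ ∃ i : ℤ,
            IsEisensteinZ p 2 ((toPolyZ 2 a).comp (X + C i))) ∧
          ∀ j, -(B : ℤ) ≤ a j ∧ a j < B}.ncard : ℝ)) / (2 * (B : ℝ)) ^ 3)
      atTop (nhds 1) := by
  classical
  have hset : ∀ B : ℕ, {a : Fin 3 → ℤ |
          (∃ p : ℕ, p.Prime ∧ ∃ i : ℤ,
            IsEisensteinZ p 2 ((toPolyZ 2 a).comp (X + C i))) ∧
          ∀ j, -(B : ℤ) ≤ a j ∧ a j < B}.ncard = ((box B).filter ShiftedEis).card := by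
    intro B
    rw [← Set.ncard_coe_finset]
    congr 1
    ext a
    simp [box, ShiftedEis, Fintype.mem_piFinset, and_comm]
  simp_rw [hset]
  have hadd : ∀ B : ℕ, (((box B).filter ShiftedEis).card : ℝ) +
      ((box B).filter (fun a => ¬ ShiftedEis a)).card = (2 * B) ^ 3 := by
    intro B
    have := Finset.card_filter_add_card_filter_not (s := box B) ShiftedEis
    rw [card_box] at this
    exact_mod_cast this
  rw [tendsto_order]
  constructor
  · intro c hc
    obtain ⟨S, hS, hexp⟩ := exists_S (1 - c) (by linarith)
    obtain ⟨N, hN, W, hW, hcard⟩ := exists_W S hS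
    set η := Real.exp (-(4 / 9) * ∑ p ∈ S, (1 / p : ℝ)) with hη
    have hNr : (0 : ℝ) < N := by exact_mod_cast hN
    have hlim : Tendsto (fun B : ℕ => η * (1 + (N / 2 : ℝ) / (B : ℝ)) ^ 3) atTop (nhds (η * (1 + 0) ^ 3)) :=
      ((tendsto_const_nhds.add (tendsto_const_div_atTop_nhds_zero_nat _)).pow 3).const_mul _
    have hev := hlim.eventually_lt_const (show η * (1 + 0) ^ 3 < 1 - c by simpa using hexp)
    filter_upwards [hev, eventually_gt_atTop 0] with B hB hB0
    have hBr : (0 : ℝ) < B := by exact_mod_cast hB0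
    have hbad : (((box B).filter (fun a => ¬ ShiftedEis a)).card : ℝ) ≤
        η * (1 + (N / 2 : ℝ) / (B : ℝ)) ^ 3 * (2 * B) ^ 3 := by
      calc _ ≤ (((box B).filter (fun a => (fun j => (a j : ZMod N)) ∈ W)).card : ℝ) := by
            exact_mod_cast Finset.card_le_card
              (Finset.monotone_filter_right _ (fun a _ ha => hW a ha))
        _ ≤ W.card * (2 * B / N + 1) ^ 3 := card_box_filter B N hN W
        _ ≤ (N : ℝ) ^ 3 * η * (2 * B / N + 1) ^ 3 := by gcongr
        _ = _ := by field_simp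
    rw [lt_div_iff₀ (by positivity)]
    have h8 : (0 : ℝ) < (2 * B) ^ 3 := by positivity
    have := hadd B
    have := mul_lt_mul_of_pos_right hB h8
    linarith
  · intro c hc
    filter_upwards [eventually_gt_atTop 0] with B hB0
    have hBr : (0 : ℝ) < B := by exact_mod_cast hB0
    have h8 : (0 : ℝ) < (2 * B) ^ 3 := by positivity
    rw [div_lt_iff₀ h8]
    have := hadd B
    have : (0 : ℝ) ≤ ((box B).filter (fun a => ¬ ShiftedEis a)).card := by positivity
    nlinarith
end

section
/- Let n ≥ 3. The natural density of the set Ẽ ⊆ ℤ^{n+1} of affine Eisenstein polynomials of degree n exists and equals 1 − ∏_{p prime} (1 − (p+1)(p−1)²/p^{n+2}). -/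
open Polynomial Filter

/-- The affine transformation `f * A` of a polynomial `f` of degree at most `n`
by a `2×2` matrix `A = [[a, b], [c, d]]`:
`f * A = Σ_{i=0}^n αᵢ (ax + b)^i (cx + d)^{n-i}`. -/
noncomputable def affTrans {R : Type*} [CommRing R] (n : ℕ) (f : Polynomial R)
    (A : Matrix (Fin 2) (Fin 2) R) : Polynomial R :=
  ∑ i ∈ Finset.range (n + 1),
    C (f.coeff i) * (C (A 0 0) * X + C (A 0 1)) ^ i * (C (A 1 0) * X + C (A 1 1)) ^ (n - i)

section PartA

lemma aff_eq_aeval {R : Type*} [CommRing R] (n : ℕ) (f : Polynomial R)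
    (A : Matrix (Fin 2) (Fin 2) R) :
    affTrans n f A = MvPolynomial.aeval ![C (A 0 0) * X + C (A 0 1), C (A 1 0) * X + C (A 1 1)]
      (f.homogenize n) := by
  unfold affTrans Polynomial.homogenize
  rw [map_sum, Finset.Nat.sum_antidiagonal_eq_sum_range_succ_mk]
  refine Finset.sum_congr rfl fun i hi => ?_
  rw [MvPolynomial.aeval_monomial, Finsupp.prod_fintype _ _ (by simp)]
  simp [Fin.prod_univ_two, mul_assoc]

lemma hom_aff {R : Type*} [CommRing R] (n : ℕ) (f : Polynomial R)
    (A : Matrix (Fin 2) (Fin 2) R) :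
    (affTrans n f A).homogenize n =
      MvPolynomial.aeval ![MvPolynomial.C (A 0 0) * MvPolynomial.X 0 +
        MvPolynomial.C (A 0 1) * MvPolynomial.X 1,
        MvPolynomial.C (A 1 0) * MvPolynomial.X 0 +
        MvPolynomial.C (A 1 1) * MvPolynomial.X 1] (f.homogenize n) := by
  apply homogenize_eq_of_isHomogeneous
  · have := (isHomogeneous_homogenize (n := n) f).aeval (n := 1)
      ![MvPolynomial.C (A 0 0) * MvPolynomial.X 0 +
        MvPolynomial.C (A 0 1) * MvPolynomial.X 1,
        MvPolynomial.C (A 1 0) * MvPolynomial.X 0 +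
        MvPolynomial.C (A 1 1) * (MvPolynomial.X 1 : MvPolynomial (Fin 2) R)] ?_
    · simpa using this
    · intro i
      fin_cases i
      · exact ((MvPolynomial.isHomogeneous_X _ _).C_mul _).add
          ((MvPolynomial.isHomogeneous_X _ _).C_mul _)
      · exact ((MvPolynomial.isHomogeneous_X _ _).C_mul _).add
          ((MvPolynomial.isHomogeneous_X _ _).C_mul _)
  · rw [aff_eq_aeval, ← AlgHom.comp_apply, MvPolynomial.comp_aeval]
    congr 2
    ext i
    fin_cases i <;> simp

lemma affTrans_comp {R : Type*} [CommRing R] (n : ℕ) (f : Polynomial R)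
    (A B : Matrix (Fin 2) (Fin 2) R) :
    affTrans n (affTrans n f A) B = affTrans n f (A * B) := by
  rw [aff_eq_aeval, hom_aff, aff_eq_aeval, ← AlgHom.comp_apply, MvPolynomial.comp_aeval]
  congr 2
  ext1 i
  fin_cases i <;> simp [Matrix.mul_apply, Fin.sum_univ_two] <;> ring

lemma affTrans_smul {R : Type*} [CommRing R] (n : ℕ) (f : Polynomial R)
    (t : R) (A : Matrix (Fin 2) (Fin 2) R) :
    affTrans n f (t • A) = C (t ^ n) * affTrans n f A := by
  unfold affTrans
  rw [Finset.mul_sum]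
  refine Finset.sum_congr rfl fun i hi => ?_
  have hi' : i + (n - i) = n := by have := Finset.mem_range.1 hi; omega
  have : C (t ^ n) = (C t) ^ i * (C t) ^ (n - i) := by rw [← pow_add, hi', C_pow]
  rw [this]
  simp only [Matrix.smul_apply, smul_eq_mul, C_mul]
  have h1 : C t * C (A 0 0) * X + C t * C (A 0 1) = C t * (C (A 0 0) * X + C (A 0 1)) := by ring
  have h2 : C t * C (A 1 0) * X + C t * C (A 1 1) = C t * (C (A 1 0) * X + C (A 1 1)) := by ring
  rw [h1, h2, mul_pow, mul_pow]
  ring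

lemma affTrans_one {R : Type*} [CommRing R] (n : ℕ) (f : Polynomial R) (hf : f.natDegree ≤ n) :
    affTrans n f 1 = f := by
  rw [aff_eq_aeval]
  simpa using aeval_homogenize_X_one f hf

lemma natDegree_term {R : Type*} [CommRing R] (n i : ℕ) (hi : i ≤ n) (a b c d : R) :
    ((C a * X + C b) ^ i * (C c * X + C d) ^ (n - i)).natDegree ≤ n := by
  refine natDegree_mul_le.trans ?_
  have h1 : ((C a * X + C b) ^ i).natDegree ≤ i := by
    refine (natDegree_pow_le_of_le i (natDegree_linear_le)).trans (by simp)
  have h2 : ((C c * X + C d) ^ (n - i)).natDegree ≤ n - i := by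
    refine (natDegree_pow_le_of_le _ (natDegree_linear_le)).trans (by simp)
  omega

lemma natDegree_affTrans {R : Type*} [CommRing R] (n : ℕ) (f : Polynomial R)
    (A : Matrix (Fin 2) (Fin 2) R) : (affTrans n f A).natDegree ≤ n := by
  unfold affTrans
  refine natDegree_sum_le_of_forall_le _ _ fun i hi => ?_
  have := Finset.mem_range.1 hi
  rw [mul_assoc]
  exact (natDegree_C_mul_le _ _).trans (natDegree_term n i (by omega) _ _ _ _)

lemma coeff_zero_affTrans {R : Type*} [CommRing R] (n : ℕ) (f : Polynomial R)
    (A : Matrix (Fin 2) (Fin 2) R) :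
    (affTrans n f A).coeff 0 =
      ∑ i ∈ Finset.range (n + 1), f.coeff i * A 0 1 ^ i * A 1 1 ^ (n - i) := by
  rw [coeff_zero_eq_eval_zero, affTrans, eval_finsetSum]
  simp

lemma coeff_top_affTrans {R : Type*} [CommRing R] (n : ℕ) (f : Polynomial R)
    (A : Matrix (Fin 2) (Fin 2) R) :
    (affTrans n f A).coeff n =
      ∑ i ∈ Finset.range (n + 1), f.coeff i * A 0 0 ^ i * A 1 0 ^ (n - i) := by
  rw [affTrans, finsetSum_coeff]
  refine Finset.sum_congr rfl fun i hi => ?_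
  have hi' : i + (n - i) = n := by have := Finset.mem_range.1 hi; omega
  rw [mul_assoc, coeff_C_mul, mul_assoc]
  congr 1
  have h1 : ((C (A 0 0) * X + C (A 0 1)) ^ i).coeff i = A 0 0 ^ i := by
    have := coeff_pow_of_natDegree_le (m := i) (natDegree_linear_le (a := A 0 0) (b := A 0 1))
    simpa using this
  have h2 : ((C (A 1 0) * X + C (A 1 1)) ^ (n - i)).coeff (n - i) = A 1 0 ^ (n - i) := by
    have := coeff_pow_of_natDegree_le (m := n - i) (natDegree_linear_le (a := A 1 0) (b := A 1 1))
    simpa using this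
  conv_lhs => rw [← hi']
  rw [coeff_mul_add_eq_of_natDegree_le, hi', h1, h2]
  · exact (natDegree_pow_le_of_le i (natDegree_linear_le)).trans (by simp)
  · rw [hi']; exact (natDegree_pow_le_of_le _ (natDegree_linear_le)).trans (by simp)

/-- coefficient conditions of Eisenstein -/
def EisC (p n : ℕ) (g : Polynomial ℤ) : Prop :=
  ¬ (p : ℤ) ∣ g.coeff n ∧ (∀ i < n, (p : ℤ) ∣ g.coeff i) ∧ ¬ (p : ℤ) ^ 2 ∣ g.coeff 0

lemma isEis_iff (p n : ℕ) (g : Polynomial ℤ) (hg : g.natDegree ≤ n) :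
    IsEisensteinZ p n g ↔ EisC p n g := by
  refine ⟨fun h => h.2, fun h => ⟨le_antisymm hg ?_, h⟩⟩
  apply le_natDegree_of_ne_zero
  intro h0
  apply h.1
  simp [h0]

lemma eis_dvd_sub0 (p n : ℕ) (g : Polynomial ℤ) (hE : EisC p n g)
    (B : Matrix (Fin 2) (Fin 2) ℤ) :
    C (p : ℤ) ∣ affTrans n g B - C (g.coeff n) * (C (B 0 0) * X + C (B 0 1)) ^ n := by
  have : affTrans n g B - C (g.coeff n) * (C (B 0 0) * X + C (B 0 1)) ^ n =
      ∑ i ∈ Finset.range n, C (g.coeff i) * (C (B 0 0) * X + C (B 0 1)) ^ i *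
        (C (B 1 0) * X + C (B 1 1)) ^ (n - i) := by
    rw [affTrans, Finset.sum_range_succ]
    simp
  rw [this]
  refine Finset.dvd_sum fun i hi => ?_
  rw [mul_assoc]
  exact Dvd.dvd.mul_right (C_dvd_iff_dvd_coeff _ _ |>.2 fun j => by
    rw [coeff_C]; split_ifs
    · exact hE.2.1 i (Finset.mem_range.1 hi)
    · simp) _

lemma eis_dvd_sub (p n : ℕ) (g : Polynomial ℤ) (hE : EisC p n g) 
    (B : Matrix (Fin 2) (Fin 2) ℤ) (hB : (p : ℤ) ∣ B 0 1) :
    C (p : ℤ) ∣ affTrans n g B - C (g.coeff n * B 0 0 ^ n) * X ^ n := by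
  have : affTrans n g B - C (g.coeff n * B 0 0 ^ n) * X ^ n =
      ∑ i ∈ Finset.range n, C (g.coeff i) * (C (B 0 0) * X + C (B 0 1)) ^ i *
        (C (B 1 0) * X + C (B 1 1)) ^ (n - i) +
      C (g.coeff n) * ((C (B 0 0) * X + C (B 0 1)) ^ n - (C (B 0 0) * X) ^ n) := by
    rw [affTrans, Finset.sum_range_succ]
    simp [mul_pow]
    ring
  rw [this]
  refine dvd_add (Finset.dvd_sum fun i hi => ?_) ?_
  · rw [mul_assoc]
    exact Dvd.dvd.mul_right (C_dvd_iff_dvd_coeff _ _ |>.2 fun j => by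
      rw [coeff_C]; split_ifs
      · exact hE.2.1 i (Finset.mem_range.1 hi)
      · simp) _
  · refine Dvd.dvd.mul_left (dvd_trans ?_ (sub_dvd_pow_sub_pow _ _ n)) _
    simpa using map_dvd C hB

lemma eis_lower (p n : ℕ) (hn : 2 ≤ n) (hp : p.Prime) (g : Polynomial ℤ) (hE : EisC p n g)
    (B : Matrix (Fin 2) (Fin 2) ℤ) (hB : (p : ℤ) ∣ B 0 1) (he : ¬ (p : ℤ) ∣ B 0 0)
    (hh : ¬ (p : ℤ) ∣ B 1 1) : EisC p n (affTrans n g B) := by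
  have hpz : Prime (p : ℤ) := Nat.prime_iff_prime_int.1 hp
  have hd := (C_dvd_iff_dvd_coeff _ _).1 (eis_dvd_sub p n g hE B hB)
  refine ⟨fun h => ?_, fun i hi => ?_, fun h => ?_⟩
  · have := hd n
    rw [coeff_sub, coeff_C_mul, coeff_X_pow_self, mul_one] at this
    have h3 := (dvd_sub_right h).1 this
    rcases hpz.dvd_or_dvd h3 with h4 | h4
    · exact hE.1 h4
    · exact he (hpz.dvd_of_dvd_pow h4)
  · have := hd i
    rw [coeff_sub, coeff_C_mul, coeff_X_pow, if_neg hi.ne, mul_zero, sub_zero] at this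
    exact this
  · rw [coeff_zero_affTrans, Finset.sum_range_succ'] at h
    have h1 : (p : ℤ) ^ 2 ∣ ∑ k ∈ Finset.range n,
        g.coeff (k + 1) * B 0 1 ^ (k + 1) * B 1 1 ^ (n - (k + 1)) := by
      refine Finset.dvd_sum fun k hk => Dvd.dvd.mul_right ?_ _
      rcases Nat.eq_zero_or_pos k with rfl | hk0
      · rw [sq]
        exact mul_dvd_mul (hE.2.1 _ (by omega)) (by simpa using hB)
      · exact Dvd.dvd.mul_left ((pow_dvd_pow _ (by omega)).trans (pow_dvd_pow_of_dvd hB _)) _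
    have h2 := (dvd_add_right h1).1 h
    simp only [pow_zero, mul_one, Nat.sub_zero] at h2
    have h3 : IsCoprime ((p : ℤ) ^ 2) (B 1 1 ^ n) :=
      IsCoprime.pow ((Prime.coprime_iff_not_dvd hpz).2 hh)
    exact hE.2.2 (h3.dvd_of_dvd_mul_right h2)

lemma eis_det (p n : ℕ) (hn : 2 ≤ n) (hp : p.Prime) (f : Polynomial ℤ)
    (A : Matrix (Fin 2) (Fin 2) ℤ) (hE : EisC p n (affTrans n f A)) :
    ¬ (p : ℤ) ∣ A 0 0 * A 1 1 - A 0 1 * A 1 0 := by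
  intro hdet
  have hpz : Prime (p : ℤ) := Nat.prime_iff_prime_int.1 hp
  have h0 := hE.2.1 0 (by omega)
  have hn' := hE.1
  have hz := hE.2.2
  rw [coeff_zero_affTrans] at h0 hz
  rw [coeff_top_affTrans] at hn'
  have key : ∀ x y : ℤ, (p : ℤ) ∣ x * A 0 1 - y * A 0 0 → (p : ℤ) ∣ x * A 1 1 - y * A 1 0 →
      (p : ℤ) ∣ y := by
    intro x y h1 h2
    have h3 : (p : ℤ) ∣ x ^ n * ∑ i ∈ Finset.range (n + 1), f.coeff i * A 0 1 ^ i * A 1 1 ^ (n - i)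
        - y ^ n * ∑ i ∈ Finset.range (n + 1), f.coeff i * A 0 0 ^ i * A 1 0 ^ (n - i) := by
      rw [Finset.mul_sum, Finset.mul_sum, ← Finset.sum_sub_distrib]
      refine Finset.dvd_sum fun i hi => ?_
      have hi' : i + (n - i) = n := by have := Finset.mem_range.1 hi; omega
      have e : x ^ n * (f.coeff i * A 0 1 ^ i * A 1 1 ^ (n - i)) -
          y ^ n * (f.coeff i * A 0 0 ^ i * A 1 0 ^ (n - i)) =
          f.coeff i * ((x * A 0 1) ^ i * (x * A 1 1) ^ (n - i) -
            (y * A 0 0) ^ i * (y * A 1 0) ^ (n - i)) := by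
        have e1 : ∀ z : ℤ, z ^ n = z ^ i * z ^ (n - i) := fun z => by rw [← pow_add, hi']
        rw [e1 x, e1 y]
        simp only [mul_pow]
        ring
      rw [e]
      refine Dvd.dvd.mul_left ?_ _
      have a1 : x * A 0 1 ≡ y * A 0 0 [ZMOD p] := (Int.modEq_iff_dvd.2 h1).symm
      have a2 : x * A 1 1 ≡ y * A 1 0 [ZMOD p] := (Int.modEq_iff_dvd.2 h2).symm
      exact Int.modEq_iff_dvd.1 ((a1.pow i).mul (a2.pow (n - i))).symm
    have h4 := (dvd_sub_right (h0.mul_left _)).1 h3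
    rcases hpz.dvd_or_dvd h4 with h5 | h5
    · exact hpz.dvd_of_dvd_pow h5
    · exact absurd h5 hn'
  have hb : (p : ℤ) ∣ A 0 1 := key (A 0 0) (A 0 1) (by rw [mul_comm (A 0 0), sub_self]; exact dvd_zero _)
    (by simpa using hdet)
  have hd : (p : ℤ) ∣ A 1 1 := key (A 1 0) (A 1 1)
    (by rw [← dvd_neg]; refine hdet.trans (dvd_of_eq ?_); ring)
    (by rw [mul_comm (A 1 0), sub_self]; exact dvd_zero _)
  apply hz
  refine Finset.dvd_sum fun i hi => ?_
  have hi' : i + (n - i) = n := by have := Finset.mem_range.1 hi; omega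
  rw [mul_assoc]
  refine Dvd.dvd.mul_left ?_ _
  refine (pow_dvd_pow (p : ℤ) hn).trans ?_
  nth_rewrite 1 [← hi']
  rw [pow_add]
  exact mul_dvd_mul (pow_dvd_pow_of_dvd hb _) (pow_dvd_pow_of_dvd hd _)

/-- representatives of the projective line -/
def AP (p i : ℕ) : Matrix (Fin 2) (Fin 2) ℤ :=
  if i < p then !![1, (i : ℤ); 0, 1] else !![0, 1; 1, 0]

/-- inverse of `AP` -/
def AQ (p i : ℕ) : Matrix (Fin 2) (Fin 2) ℤ :=
  if i < p then !![1, -(i : ℤ); 0, 1] else !![0, 1; 1, 0]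

lemma AP_mul_AQ (p i : ℕ) : AP p i * AQ p i = 1 := by
  unfold AP AQ
  split_ifs
  · ext a b; fin_cases a <;> fin_cases b <;> simp [Matrix.mul_apply, Fin.sum_univ_two]
  · ext a b; fin_cases a <;> fin_cases b <;> simp [Matrix.mul_apply, Fin.sum_univ_two]

lemma EisC_C_mul (p n : ℕ) (hp : p.Prime) (t : ℤ) (ht : ¬ (p : ℤ) ∣ t) (g : Polynomial ℤ)
    (h : EisC p n (C t * g)) : EisC p n g := by
  have hpz : Prime (p : ℤ) := Nat.prime_iff_prime_int.1 hp
  obtain ⟨h1, h2, h3⟩ := h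
  simp only [coeff_C_mul] at h1 h2 h3
  exact ⟨fun h => h1 (h.mul_left _), fun i hi => (hpz.dvd_or_dvd (h2 i hi)).resolve_left ht,
    fun h => h3 (h.mul_left _)⟩

lemma eis_reduce (p n : ℕ) (hn : 2 ≤ n) (hp : p.Prime) (f : Polynomial ℤ)
    (A : Matrix (Fin 2) (Fin 2) ℤ) (hE : EisC p n (affTrans n f A)) :
    ∃ i < p + 1, EisC p n (affTrans n f (AP p i)) := by
  have hpz : Prime (p : ℤ) := Nat.prime_iff_prime_int.1 hp
  have hdet := eis_det p n hn hp f A hE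
  set D := A 0 0 * A 1 1 - A 0 1 * A 1 0 with hD
  have hprod : ∀ P : Matrix (Fin 2) (Fin 2) ℤ,
      A * (!![A 1 1, - A 0 1; - A 1 0, A 0 0] * P) = D • P := by
    intro P
    rw [← mul_assoc]
    have : A * !![A 1 1, - A 0 1; - A 1 0, A 0 0] = D • 1 := by
      ext a b; fin_cases a <;> fin_cases b <;> simp [Matrix.mul_apply, Fin.sum_univ_two, hD] <;> ring
    rw [this]; simp
  have main : ∀ i, (p : ℤ) ∣ (!![A 1 1, - A 0 1; - A 1 0, A 0 0] * AP p i) 0 1 →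
      ¬ (p : ℤ) ∣ (!![A 1 1, - A 0 1; - A 1 0, A 0 0] * AP p i) 0 0 *
        (!![A 1 1, - A 0 1; - A 1 0, A 0 0] * AP p i) 1 1 → 
      EisC p n (affTrans n f (AP p i)) := by
    intro i h1 h2
    have := eis_lower p n hn hp _ hE _ h1 (fun h => h2 (h.mul_right _))
      (fun h => h2 (h.mul_left _))
    rw [affTrans_comp, hprod, affTrans_smul] at this
    exact EisC_C_mul p n hp _ (fun h => hdet (hpz.dvd_of_dvd_pow h)) _ this
  by_cases hd : (p : ℤ) ∣ A 1 1
  · refine ⟨p, by omega, main p ?_ ?_⟩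
    · simpa [AP, Matrix.mul_apply, Fin.sum_univ_two] using hd
    · simp only [AP, lt_irrefl, if_false, Matrix.mul_apply, Fin.sum_univ_two]
      simp
      intro h
      apply hdet
      rw [hD]
      exact dvd_sub (hd.mul_left _) h
  · obtain ⟨u, v, huv⟩ := (Prime.coprime_iff_not_dvd hpz).2 hd
    have hp0 : (0 : ℤ) < p := by exact_mod_cast hp.pos
    obtain ⟨i, hi⟩ : ∃ i : ℕ, (i : ℤ) = (v * A 0 1) % p :=
      ⟨((v * A 0 1) % p).toNat, Int.toNat_of_nonneg (Int.emod_nonneg _ hp0.ne')⟩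
    have hip : i < p := by have := Int.emod_lt_of_pos (v * A 0 1) hp0; omega
    have h1 : (p : ℤ) ∣ A 1 1 * i - A 0 1 := by
      have e : (p : ℤ) ∣ v * A 0 1 - i := by
        rw [hi]; exact Int.dvd_self_sub_emod
      have : A 1 1 * i - A 0 1 = - (A 1 1 * (v * A 0 1 - i)) - p * (u * A 0 1) := by
        linear_combination (A 0 1) * huv
      rw [this]
      exact dvd_sub ((e.mul_left _).neg_right) (dvd_mul_right _ _)
    refine ⟨i, by omega, main i ?_ ?_⟩
    · simpa [AP, hip, Matrix.mul_apply, Fin.sum_univ_two, sub_eq_add_neg] using h1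
    · simp only [AP, if_pos hip, Matrix.mul_apply, Fin.sum_univ_two]
      simp
      intro h
      apply hdet
      have : D = A 1 1 * (-(A 1 0 * ↑i) + A 0 0) + A 1 0 * (A 1 1 * i - A 0 1) := by
        rw [hD]; ring
      rw [this]
      exact dvd_add h (h1.mul_left _)

end PartA

section PartB

/-- matrix of the affine transformation on coefficient vectors -/
noncomputable def mA (n : ℕ) (A : Matrix (Fin 2) (Fin 2) ℤ) :
    Matrix (Fin (n + 1)) (Fin (n + 1)) ℤ :=
  fun k i => ((C (A 0 0) * X + C (A 0 1)) ^ (i : ℕ) *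
    (C (A 1 0) * X + C (A 1 1)) ^ (n - (i : ℕ))).coeff k

lemma toPolyZ_coeff (n : ℕ) (a : Fin (n + 1) → ℤ) (k : Fin (n + 1)) :
    (toPolyZ n a).coeff k = a k := by
  rw [toPolyZ, finsetSum_coeff]
  simp only [coeff_C_mul, coeff_X_pow]
  rw [Finset.sum_eq_single k]
  · simp
  · intro b _ hb
    rw [if_neg (fun h => hb (Fin.ext h.symm)), mul_zero]
  · simp

lemma natDegree_toPolyZ (n : ℕ) (a : Fin (n + 1) → ℤ) : (toPolyZ n a).natDegree ≤ n := by
  unfold toPolyZ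
  refine natDegree_sum_le_of_forall_le _ _ fun i _ => ?_
  exact (natDegree_C_mul_X_pow_le _ _).trans (Nat.lt_succ_iff.1 i.2)

lemma coeff_aff (n : ℕ) (a : Fin (n + 1) → ℤ) (A : Matrix (Fin 2) (Fin 2) ℤ) (k : Fin (n + 1)) :
    (affTrans n (toPolyZ n a) A).coeff k = (mA n A).mulVec a k := by
  rw [affTrans, finsetSum_coeff, Finset.sum_range]
  simp only [Matrix.mulVec, dotProduct, mA]
  refine Finset.sum_congr rfl fun i _ => ?_
  rw [toPolyZ_coeff, mul_assoc, coeff_C_mul, mul_comm]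

lemma toPolyZ_eq (n : ℕ) (g : Polynomial ℤ) (hg : g.natDegree ≤ n) :
    toPolyZ n (fun k => g.coeff k) = g := by
  ext j
  by_cases hj : j < n + 1
  · exact toPolyZ_coeff n _ ⟨j, hj⟩
  · rw [coeff_eq_zero_of_natDegree_lt, coeff_eq_zero_of_natDegree_lt]
    · omega
    · have := natDegree_toPolyZ n (fun k => g.coeff k); omega

lemma mA_comp (n : ℕ) (A B : Matrix (Fin 2) (Fin 2) ℤ) (hAB : A * B = 1) : mA n B * mA n A = 1 := by
  apply Matrix.toLin'.injective
  ext1 i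
  ext x
  simp only [LinearMap.comp_apply, Matrix.toLin'_apply]
  rw [← Matrix.mulVec_mulVec, Matrix.one_mulVec]
  set a : Fin (n + 1) → ℤ := (LinearMap.single ℤ (fun _ => ℤ) i) 1
  have h1 : (mA n A).mulVec a = fun k : Fin (n + 1) => (affTrans n (toPolyZ n a) A).coeff k := by
    ext k; rw [coeff_aff]
  rw [← coeff_aff, h1, toPolyZ_eq _ _ (natDegree_affTrans _ _ _), affTrans_comp, hAB,
    affTrans_one _ _ (natDegree_toPolyZ _ _), toPolyZ_coeff]

/-- Eisenstein vectors -/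
def EisV (p n : ℕ) (w : Fin (n + 1) → ℤ) : Prop :=
  ¬ (p : ℤ) ∣ w (Fin.last n) ∧ (∀ i, i ≠ Fin.last n → (p : ℤ) ∣ w i) ∧ ¬ (p : ℤ) ^ 2 ∣ w 0

/-- affine `p`-Eisenstein vectors -/
def ES (p n : ℕ) : Set (Fin (n + 1) → ℤ) :=
  {a | ∃ A : Matrix (Fin 2) (Fin 2) ℤ, IsEisensteinZ p n (affTrans n (toPolyZ n a) A)}

lemma EisC_iff_EisV (p n : ℕ) (a : Fin (n + 1) → ℤ) (A : Matrix (Fin 2) (Fin 2) ℤ) :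
    EisC p n (affTrans n (toPolyZ n a) A) ↔ EisV p n ((mA n A).mulVec a) := by
  unfold EisC EisV
  simp only [← coeff_aff, Fin.val_last, Fin.val_zero]
  refine and_congr_right fun _ => and_congr_left fun _ => ?_
  refine ⟨fun h i hi => h i ?_, fun h i hi => ?_⟩
  · exact Fin.val_lt_last hi
  · exact h ⟨i, by omega⟩ (by simp [Fin.ext_iff]; omega)

lemma mem_ES_iff (p n : ℕ) (hn : 2 ≤ n) (hp : p.Prime) (a : Fin (n + 1) → ℤ) :
    a ∈ ES p n ↔ ∃ i < p + 1, EisV p n ((mA n (AP p i)).mulVec a) := by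
  simp only [← EisC_iff_EisV]
  constructor
  · rintro ⟨A, hA⟩
    rw [isEis_iff _ _ _ (natDegree_affTrans _ _ _)] at hA
    exact eis_reduce p n hn hp _ A hA
  · rintro ⟨i, _, hA⟩
    exact ⟨AP p i, (isEis_iff _ _ _ (natDegree_affTrans _ _ _)).2 hA⟩

lemma AQ_mul_AP (p i : ℕ) : AQ p i * AP p i = 1 := 
  mul_eq_one_comm.1 (AP_mul_AQ p i)

lemma AQAP (p i j : ℕ) (hp : p.Prime) (hi : i < p + 1) (hj : j < p + 1) (hij : i ≠ j) :
    ¬ (p : ℤ) ∣ (AQ p j * AP p i) 0 1 := by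
  have hp1 : ¬ (p : ℤ) ∣ 1 := by
    intro h
    exact hp.one_lt.ne' (by simpa using Int.natAbs_dvd_natAbs.2 h)
  unfold AP AQ
  split_ifs with h1 h2 h2
  · simp only [Matrix.mul_apply, Fin.sum_univ_two]
    simp
    intro h
    have := Int.eq_zero_of_abs_lt_dvd h (by rw [abs_lt]; constructor <;> omega)
    omega
  · simpa [Matrix.mul_apply, Fin.sum_univ_two] using hp1
  · simpa [Matrix.mul_apply, Fin.sum_univ_two] using hp1
  · omega

lemma ES_disj (p n : ℕ) (hn : 2 ≤ n) (hp : p.Prime) (a : Fin (n + 1) → ℤ) (i j : ℕ)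
    (hi : i < p + 1) (hj : j < p + 1) (hij : i ≠ j)
    (h1 : EisV p n ((mA n (AP p i)).mulVec a)) (h2 : EisV p n ((mA n (AP p j)).mulVec a)) :
    False := by
  have hpz : Prime (p : ℤ) := Nat.prime_iff_prime_int.1 hp
  rw [← EisC_iff_EisV] at h1 h2
  have h3 := (C_dvd_iff_dvd_coeff _ _).1 (eis_dvd_sub0 p n _ h2 (AQ p j * AP p i)) 0
  rw [affTrans_comp, ← mul_assoc, AP_mul_AQ, one_mul, coeff_sub] at h3
  have h4 := (dvd_sub_right (h1.2.1 0 (by omega))).1 h3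
  rw [coeff_C_mul, coeff_zero_eq_eval_zero] at h4
  simp only [eval_pow, eval_add, eval_mul, eval_C, eval_X, mul_zero, zero_add] at h4
  rcases hpz.dvd_or_dvd h4 with h5 | h5
  · exact h2.1 h5
  · exact AQAP p i j hp hi hj hij (hpz.dvd_of_dvd_pow h5)

lemma ES_modp (p n : ℕ) (hn : 2 ≤ n) (hp : p.Prime) (a : Fin (n + 1) → ℤ) (ha : a ∈ ES p n) :
    ∃ c s t : ℤ, (s = 1 ∨ (s = 0 ∧ t = 1)) ∧
      ∀ k : Fin (n + 1), (p : ℤ) ∣ a k - c * ((n.choose k : ℤ) * s ^ (k : ℕ) * t ^ (n - (k : ℕ))) := by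
  obtain ⟨i, hi, hE⟩ := (mem_ES_iff p n hn hp a).1 ha
  rw [← EisC_iff_EisV] at hE
  have h3 := (C_dvd_iff_dvd_coeff _ _).1 (eis_dvd_sub0 p n _ hE (AQ p i))
  rw [affTrans_comp, AP_mul_AQ, affTrans_one _ _ (natDegree_toPolyZ _ _)] at h3
  set c := (affTrans n (toPolyZ n a) (AP p i)).coeff n
  by_cases hip : i < p
  · refine ⟨c, 1, -i, Or.inl rfl, fun k => ?_⟩
    have := h3 k
    rw [coeff_sub, toPolyZ_coeff, coeff_C_mul] at this
    have e : (C (AQ p i 0 0) * X + C (AQ p i 0 1)) = X + C (-(i : ℤ)) := by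
      simp [AQ, hip]
    rw [e, coeff_X_add_C_pow] at this
    refine this.trans (dvd_of_eq ?_)
    ring
  · refine ⟨c, 0, 1, Or.inr ⟨rfl, rfl⟩, fun k => ?_⟩
    have := h3 k
    rw [coeff_sub, toPolyZ_coeff, coeff_C_mul] at this
    have e : (C (AQ p i 0 0) * X + C (AQ p i 0 1)) = 1 := by
      simp [AQ, hip]
    rw [e, one_pow, coeff_one] at this
    refine this.trans (dvd_of_eq ?_)
    by_cases hk : (k : ℕ) = 0 <;> simp [hk]

/-- `p`-affine Eisenstein vectors have nonzero top coefficient. -/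
lemma ES_natDegree (p n : ℕ) (hn : 2 ≤ n) (hp : p.Prime) (a : Fin (n + 1) → ℤ) (ha : a ∈ ES p n) :
    (toPolyZ n a).natDegree = n := by
  have hpz : Prime (p : ℤ) := Nat.prime_iff_prime_int.1 hp
  obtain ⟨i, hi, hE⟩ := (mem_ES_iff p n hn hp a).1 ha
  rw [← EisC_iff_EisV] at hE
  refine le_antisymm (natDegree_toPolyZ _ _) (le_natDegree_of_ne_zero fun h0 => ?_)
  by_cases hip : i < p
  · apply hE.1
    rw [coeff_top_affTrans, Finset.sum_range_succ, h0]
    simp only [zero_mul, add_zero]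
    refine Finset.dvd_sum fun j hj => ?_
    have : n - j ≠ 0 := by have := Finset.mem_range.1 hj; omega
    simp [AP, hip, this]
  · apply hE.2.2
    rw [coeff_zero_affTrans, Finset.sum_range_succ, h0]
    simp only [zero_mul, add_zero]
    refine Finset.dvd_sum fun j hj => ?_
    have : n - j ≠ 0 := by have := Finset.mem_range.1 hj; omega
    simp [AP, hip, this]

end PartB

section PartC

/-- reduction of an integer vector mod `N` -/
def redV (d N : ℕ) (a : Fin d → ℤ) : Fin d → ZMod N := fun i => (a i : ZMod N)

lemma redV_surj (d N : ℕ) : Function.Surjective (redV d N) := by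
  intro v
  choose a ha using fun i => ZMod.intCast_surjective (v i)
  exact ⟨a, funext ha⟩

/-- `S` is periodic mod `N` with density `δ`. -/
def HasPer {d : ℕ} (S : Set (Fin d → ℤ)) (N : ℕ) (δ : ℝ) : Prop :=
  0 < N ∧ ∃ T : Finset (Fin d → ZMod N), (∀ a, a ∈ S ↔ redV d N a ∈ T) ∧
    (T.card : ℝ) = δ * (N : ℝ) ^ d

lemma HasPer.compl {d : ℕ} {S : Set (Fin d → ℤ)} {N : ℕ} {δ : ℝ} (h : HasPer S N δ) :
    HasPer Sᶜ N (1 - δ) := by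
  classical
  obtain ⟨hN, T, hT, hc⟩ := h
  have : NeZero N := ⟨hN.ne'⟩
  refine ⟨hN, Tᶜ, fun a => ?_, ?_⟩
  · simp [hT a]
  · rw [Finset.card_compl, Nat.cast_sub (Finset.card_le_univ _), hc]
    simp [ZMod.card]
    ring

lemma HasPer.univ (d : ℕ) : HasPer (Set.univ : Set (Fin d → ℤ)) 1 1 := by
  refine ⟨one_pos, Finset.univ, fun a => ⟨fun _ => Finset.mem_univ _, fun _ => trivial⟩, ?_⟩
  simp

lemma HasPer.inter {d : ℕ} {S S' : Set (Fin d → ℤ)} {N N' : ℕ} {δ δ' : ℝ} (h : HasPer S N δ)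
    (h' : HasPer S' N' δ') (hco : N.Coprime N') : HasPer (S ∩ S') (N * N') (δ * δ') := by
  classical
  obtain ⟨hN, T, hT, hc⟩ := h
  obtain ⟨hN', T', hT', hc'⟩ := h'
  have : NeZero N := ⟨hN.ne'⟩
  have : NeZero N' := ⟨hN'.ne'⟩
  have : NeZero (N * N') := ⟨(Nat.mul_pos hN hN').ne'⟩
  let e := ZMod.chineseRemainder hco
  let E : (Fin d → ZMod (N * N')) ≃ (Fin d → ZMod N) × (Fin d → ZMod N') :=
    (Equiv.piCongrRight fun _ => e.toEquiv).trans
      (Equiv.arrowProdEquivProdArrow (Fin d) (fun _ => ZMod N) (fun _ => ZMod N'))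
  have hE : ∀ a : Fin d → ℤ, E (redV d (N * N') a) = (redV d N a, redV d N' a) := by
    intro a
    ext i
    · show (e ((a i : ℤ) : ZMod (N * N'))).1 = _
      rw [map_intCast]; simp [redV]
    · show (e ((a i : ℤ) : ZMod (N * N'))).2 = _
      rw [map_intCast]; simp [redV]
  refine ⟨Nat.mul_pos hN hN', (T ×ˢ T').map E.symm.toEmbedding, fun a => ?_, ?_⟩
  · rw [Finset.mem_map_equiv, Equiv.symm_symm, hE, Finset.mem_product, ← hT, ← hT']
    rfl
  · rw [Finset.card_map, Finset.card_product]
    push_cast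
    rw [hc, hc']
    ring

lemma card_pmul (p : ℕ) (hp : p.Prime) [NeZero (p ^ 2)] :
    (Finset.univ.filter fun x : ZMod (p ^ 2) => p ∣ x.val).card = p := by
  have : (Finset.univ.filter fun x : ZMod (p ^ 2) => p ∣ x.val).card =
      ((Finset.range (p ^ 2)).filter fun x => p ∣ x).card := by
    apply Finset.card_bij (fun x _ => x.val)
    · intro x hx
      simp only [Finset.mem_filter, Finset.mem_univ, true_and] at hx
      simp [hx, ZMod.val_lt]
    · intro x _ y _ h
      exact ZMod.val_injective _ h
    · intro y hy
      simp only [Finset.mem_filter, Finset.mem_range] at hy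
      exact ⟨(y : ZMod (p ^ 2)), by simp [ZMod.val_cast_of_lt hy.1, hy.2],
        ZMod.val_cast_of_lt hy.1⟩
  rw [this]
  have h2 : ((Finset.range (p ^ 2)).filter fun x => p ∣ x) =
      (Finset.range p).image (fun k => p * k) := by
    ext x
    simp only [Finset.mem_filter, Finset.mem_range, Finset.mem_image]
    constructor
    · rintro ⟨h1, k, rfl⟩
      exact ⟨k, by rw [sq] at h1; exact Nat.lt_of_mul_lt_mul_left h1, rfl⟩
    · rintro ⟨k, hk, rfl⟩
      exact ⟨by rw [sq]; exact Nat.mul_lt_mul_of_pos_left hk hp.pos, dvd_mul_right _ _⟩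
  rw [h2, Finset.card_image_of_injective _ (fun a b h => Nat.eq_of_mul_eq_mul_left hp.pos h),
    Finset.card_range]

/-- admissible residues of coordinate `i` -/
def WS (p n : ℕ) [NeZero (p ^ 2)] (i : Fin (n + 1)) : Finset (ZMod (p ^ 2)) :=
  if i = Fin.last n then (Finset.univ.filter fun x : ZMod (p ^ 2) => p ∣ x.val)ᶜ
  else if i = 0 then (Finset.univ.filter fun x : ZMod (p ^ 2) => p ∣ x.val).erase 0
  else (Finset.univ.filter fun x : ZMod (p ^ 2) => p ∣ x.val)

lemma card_WS (p n : ℕ) (hn : 2 ≤ n) (hp : p.Prime) [NeZero (p ^ 2)] :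
    (Fintype.piFinset (WS p n)).card = (p - 1) ^ 2 * p ^ n := by
  rw [Fintype.card_piFinset]
  obtain ⟨m, rfl⟩ : ∃ m, n = m + 1 := ⟨n - 1, by omega⟩
  rw [Fin.prod_univ_castSucc, Fin.prod_univ_succ]
  have h1 : (WS p (m + 1) (Fin.castSucc 0)).card = p - 1 := by
    rw [WS, if_neg (by simp [Fin.ext_iff]), if_pos (by simp), Finset.card_erase_of_mem (by simp),
      card_pmul p hp]
  have h2 : ∀ i : Fin m, (WS p (m + 1) (Fin.castSucc i.succ)).card = p := by
    intro i
    rw [WS, if_neg (by simp [Fin.ext_iff]; omega), if_neg (by simp [Fin.ext_iff]), card_pmul p hp]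
  have h3 : (WS p (m + 1) (Fin.last (m + 1))).card = p * (p - 1) := by
    rw [WS, if_pos rfl, Finset.card_compl, card_pmul p hp, ZMod.card, Nat.mul_sub, sq, mul_one]
  rw [h1, h3]
  simp only [h2]
  simp
  ring

lemma dvd_val_iff (p : ℕ) [NeZero (p ^ 2)] (x : ℤ) :
    p ∣ ((x : ZMod (p ^ 2))).val ↔ (p : ℤ) ∣ x := by
  rw [← Int.natCast_dvd_natCast, ZMod.val_intCast]
  have h : (p : ℤ) ∣ ((p ^ 2 : ℕ) : ℤ) := by push_cast; exact dvd_pow_self _ two_ne_zero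
  exact (Int.dvd_iff_dvd_of_dvd_sub (h.trans Int.dvd_self_sub_emod)).symm

lemma EisV_iff_red (p n : ℕ) (hn : 2 ≤ n) [NeZero (p ^ 2)] (w : Fin (n + 1) → ℤ) :
    EisV p n w ↔ redV (n + 1) (p ^ 2) w ∈ Fintype.piFinset (WS p n) := by
  have h0 : (0 : Fin (n + 1)) ≠ Fin.last n := by simp [Fin.ext_iff]; omega
  have hz : ((w 0 : ℤ) : ZMod (p ^ 2)) = 0 ↔ (p : ℤ) ^ 2 ∣ w 0 := by
    rw [ZMod.intCast_zmod_eq_zero_iff_dvd]; push_cast; rfl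
  rw [Fintype.mem_piFinset, EisV]
  constructor
  · rintro ⟨h1, h2, h3⟩ i
    unfold WS redV
    split_ifs with h4 h5
    · subst h4; simpa [dvd_val_iff] using h1
    · subst h5; simp [dvd_val_iff, hz, h3, h2 _ h4]
    · simp [dvd_val_iff, h2 _ h4]
  · intro h
    refine ⟨?_, ?_, ?_⟩
    · have := h (Fin.last n)
      unfold WS redV at this
      simpa [dvd_val_iff] using this
    · intro i hi
      have := h i
      unfold WS redV at this
      rw [if_neg hi] at this
      split_ifs at this with h4
      · simp [dvd_val_iff] at this; exact this.2
      · simpa [dvd_val_iff] using this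
    · have := h 0
      unfold WS redV at this
      rw [if_neg h0, if_pos rfl] at this
      simp [dvd_val_iff, hz] at this
      exact this.1

lemma redV_mulVec (d N : ℕ) (M : Matrix (Fin d) (Fin d) ℤ) (a : Fin d → ℤ) :
    redV d N (M.mulVec a) = (M.map (Int.castRingHom (ZMod N))).mulVec (redV d N a) := by
  ext i
  have := RingHom.map_mulVec (Int.castRingHom (ZMod N)) M a i
  exact this

lemma ES_hasPer (p n : ℕ) (hn : 2 ≤ n) (hp : p.Prime) :
    HasPer (ES p n) (p ^ 2) (((p : ℝ) + 1) * ((p : ℝ) - 1) ^ 2 / (p : ℝ) ^ (n + 2)) := by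
  classical
  have : NeZero (p ^ 2) := ⟨(pow_pos hp.pos 2).ne'⟩
  let φ := Int.castRingHom (ZMod (p ^ 2))
  let W := Fintype.piFinset (WS p n)
  let TT : ℕ → Finset (Fin (n + 1) → ZMod (p ^ 2)) := fun i =>
    Finset.univ.filter fun v => ((mA n (AP p i)).map φ).mulVec v ∈ W
  have hTT : ∀ i (a : Fin (n + 1) → ℤ), redV (n + 1) (p ^ 2) a ∈ TT i ↔
      EisV p n ((mA n (AP p i)).mulVec a) := by
    intro i a
    rw [EisV_iff_red p n hn, redV_mulVec]
    simp [TT, W, φ]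
  have hinv : ∀ i, (mA n (AP p i)).map φ * (mA n (AQ p i)).map φ = 1 := by
    intro i
    rw [← Matrix.map_mul, mA_comp n _ _ (AQ_mul_AP p i)]
    simp
  have hinv' : ∀ i, (mA n (AQ p i)).map φ * (mA n (AP p i)).map φ = 1 := by
    intro i
    rw [← Matrix.map_mul, mA_comp n _ _ (AP_mul_AQ p i)]
    simp
  have hcard : ∀ i, (TT i).card = W.card := by
    intro i
    apply Finset.card_bij (fun v _ => ((mA n (AP p i)).map φ).mulVec v)
    · intro v hv
      simpa [TT] using hv
    · intro v _ v' _ h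
      have := congrArg (fun z => ((mA n (AQ p i)).map φ).mulVec z) h
      simpa [Matrix.mulVec_mulVec, hinv'] using this
    · intro w hw
      refine ⟨((mA n (AQ p i)).map φ).mulVec w, ?_, ?_⟩
      · simp [TT, Matrix.mulVec_mulVec, hinv, hw]
      · simp [Matrix.mulVec_mulVec, hinv]
  refine ⟨pow_pos hp.pos 2, (Finset.range (p + 1)).biUnion TT, fun a => ?_, ?_⟩
  · rw [mem_ES_iff p n hn hp, Finset.mem_biUnion]
    simp only [hTT, Finset.mem_range]
  · rw [Finset.card_biUnion]
    · simp only [hcard]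
      rw [Finset.sum_const, Finset.card_range, show W.card = _ from card_WS p n hn hp, smul_eq_mul]
      push_cast [hp.one_le]
      have : (p : ℝ) ≠ 0 := by exact_mod_cast hp.ne_zero
      field_simp
      ring
    · intro i hi j hj hij
      rw [Function.onFun, Finset.disjoint_left]
      intro v h1 h2
      obtain ⟨a, rfl⟩ := redV_surj _ _ v
      rw [hTT] at h1 h2
      exact ES_disj p n hn hp a i j (by simpa using hi) (by simpa using hj) hij h1 h2

lemma inter_hasPer (n : ℕ) (hn : 2 ≤ n) (s : Finset Nat.Primes) :
    HasPer (⋂ q ∈ s, (ES (q : ℕ) n)ᶜ) (∏ q ∈ s, (q : ℕ) ^ 2)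
      (∏ q ∈ s, (1 - ((q : ℝ) + 1) * ((q : ℝ) - 1) ^ 2 / (q : ℝ) ^ (n + 2))) := by
  classical
  induction s using Finset.induction_on with
  | empty => simpa using HasPer.univ (n + 1)
  | insert q s hq ih =>
    rw [Finset.prod_insert hq, Finset.prod_insert hq, Finset.set_biInter_insert]
    refine (ES_hasPer q n hn q.2).compl.inter ih ?_
    refine Nat.Coprime.prod_right fun r hr => Nat.Coprime.pow _ _ ?_
    refine (Nat.coprime_primes q.2 r.2).2 fun h => hq ?_
    have : q = r := Subtype.ext h
    rwa [this]

lemma union_hasPer (n : ℕ) (hn : 2 ≤ n) (s : Finset Nat.Primes) :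
    HasPer (⋃ q ∈ s, (ES (q : ℕ) n)) (∏ q ∈ s, (q : ℕ) ^ 2)
      (1 - ∏ q ∈ s, (1 - ((q : ℝ) + 1) * ((q : ℝ) - 1) ^ 2 / (q : ℝ) ^ (n + 2))) := by
  have := (inter_hasPer n hn s).compl
  simpa [Set.compl_iInter] using this

end PartC

section PartD

/-- the integer box -/
noncomputable def bx (d B : ℕ) : Finset (Fin d → ℤ) := Fintype.piFinset fun _ => Finset.Ico (-(B : ℤ)) B

lemma mem_bx (d B : ℕ) (a : Fin d → ℤ) : a ∈ bx d B ↔ ∀ j, -(B : ℤ) ≤ a j ∧ a j < B := by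
  simp [bx]

lemma card_bx (d B : ℕ) : (bx d B).card = (2 * B) ^ d := by
  rw [bx, Fintype.card_piFinset]
  simp
  congr 1
  omega

open Classical in
/-- the number of points of `S` in the box -/
noncomputable def cnt {d : ℕ} (S : Set (Fin d → ℤ)) (B : ℕ) : ℕ :=
  ((bx d B).filter (fun a => a ∈ S)).card

lemma cnt_mono {d : ℕ} {S S' : Set (Fin d → ℤ)} (B : ℕ) (h : ∀ a ∈ bx d B, a ∈ S → a ∈ S') :
    cnt S B ≤ cnt S' B := by
  classical
  refine Finset.card_le_card fun a ha => ?_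
  simp only [Finset.mem_filter] at ha ⊢
  exact ⟨ha.1, h a ha.1 ha.2⟩

lemma cnt_union {d : ℕ} (S S' : Set (Fin d → ℤ)) (B : ℕ) :
    cnt (S ∪ S') B ≤ cnt S B + cnt S' B := by
  classical
  unfold cnt
  refine le_trans (Finset.card_le_card fun a ha => ?_) (Finset.card_union_le _ _)
  simp only [Finset.mem_filter, Finset.mem_union, Set.mem_union] at ha ⊢
  tauto

/-- number of points in a residue class -/
noncomputable def cl (N B : ℕ) (t : ZMod N) : ℕ :=
  ((Finset.Ico (-(B : ℤ)) B).filter (fun x : ℤ => (x : ZMod N) = t)).card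

lemma cl_bound (N B : ℕ) (hN : 0 < N) (t : ZMod N) :
    |(cl N B t : ℝ) - 2 * B / N| ≤ 1 := by
  obtain ⟨v, rfl⟩ := ZMod.intCast_surjective t
  have h1 : cl N B (v : ZMod N) =
      ((Finset.Ico (-(B : ℤ)) B).filter (fun x => x ≡ v [ZMOD N])).card := by
    unfold cl
    congr 1
    ext x
    simp [ZMod.intCast_eq_intCast_iff]
  have h2 := Int.Ico_filter_modEq_card (-(B : ℤ)) B (r := N) (by exact_mod_cast hN) v
  rw [← h1] at h2
  have hN' : (0 : ℚ) < N := by exact_mod_cast hN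
  have hle : ⌈(((-(B : ℤ) : ℤ) : ℚ) - (v : ℚ)) / ((N : ℤ) : ℚ)⌉ ≤
      ⌈(((B : ℤ) : ℚ) - (v : ℚ)) / ((N : ℤ) : ℚ)⌉ := by
    apply Int.ceil_mono
    push_cast
    gcongr
    have : (0 : ℚ) ≤ B := by positivity
    linarith
  rw [max_eq_left (by linarith)] at h2
  have a1 := Int.ceil_lt_add_one ((((-(B : ℤ) : ℤ) : ℚ) - (v : ℚ)) / ((N : ℤ) : ℚ))
  have a2 := Int.le_ceil ((((-(B : ℤ) : ℤ) : ℚ) - (v : ℚ)) / ((N : ℤ) : ℚ))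
  have a3 := Int.ceil_lt_add_one ((((B : ℤ) : ℚ) - (v : ℚ)) / ((N : ℤ) : ℚ))
  have a4 := Int.le_ceil ((((B : ℤ) : ℚ) - (v : ℚ)) / ((N : ℤ) : ℚ))
  have h3 : ((cl N B (v : ZMod N) : ℤ) : ℚ) = (⌈(((B : ℤ) : ℚ) - (v : ℚ)) / ((N : ℤ) : ℚ)⌉ : ℚ) -
    (⌈(((-(B : ℤ) : ℤ) : ℚ) - (v : ℚ)) / ((N : ℤ) : ℚ)⌉ : ℚ) := by
    rw [h2]; push_cast; rfl
  have h4 : (((B : ℤ) : ℚ) - (v : ℚ)) / ((N : ℤ) : ℚ) -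
      (((-(B : ℤ) : ℤ) : ℚ) - (v : ℚ)) / ((N : ℤ) : ℚ) = 2 * B / N := by
    push_cast
    ring
  have h5 : |(cl N B (v : ZMod N) : ℚ) - 2 * B / N| ≤ 1 := by
    rw [← h4, abs_le]
    push_cast at h3
    rw [h3]
    push_cast at *
    constructor <;> linarith
  have h6 : ((|(cl N B (v : ZMod N) : ℚ) - 2 * B / N| : ℚ) : ℝ) ≤ ((1 : ℚ) : ℝ) := by
    exact_mod_cast h5
  push_cast at h6
  exact h6

open Classical in
lemma card_red (d N B : ℕ) (t : Fin d → ZMod N) :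
    ((bx d B).filter (fun a => redV d N a = t)).card = ∏ i, cl N B (t i) := by
  have : ((bx d B).filter (fun a => redV d N a = t)) = Fintype.piFinset fun i =>
      ((Finset.Ico (-(B : ℤ)) B).filter (fun x : ℤ => (x : ZMod N) = t i)) := by
    ext a
    simp only [Finset.mem_filter, bx, Fintype.mem_piFinset, redV, funext_iff]
    exact ⟨fun h i => ⟨h.1 i, h.2 i⟩, fun h => ⟨fun i => (h i).1, fun i => (h i).2⟩⟩
  rw [this, Fintype.card_piFinset]
  rfl

lemma cnt_red {d N : ℕ} (T : Finset (Fin d → ZMod N)) (S : Set (Fin d → ℤ)) (B : ℕ)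
    (h : ∀ a, a ∈ S ↔ redV d N a ∈ T) :
    cnt S B = ∑ t ∈ T, ∏ i, cl N B (t i) := by
  classical
  unfold cnt
  rw [Finset.card_eq_sum_card_fiberwise (f := redV d N) (t := T)]
  · refine Finset.sum_congr rfl fun t ht => ?_
    rw [← card_red, Finset.filter_filter]
    congr 1
    ext a
    simp only [Finset.mem_filter]
    refine and_congr_right fun _ => ⟨fun h => h.2, fun h' => ⟨?_, h'⟩⟩
    rw [h, h']; exact ht
  · intro a ha
    simp only [Finset.coe_filter, Set.mem_ofPred_eq] at ha
    exact (h a).1 ha.2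

lemma cl_tendsto (N : ℕ) (hN : 0 < N) (t : ZMod N) :
    Tendsto (fun B : ℕ => (cl N B t : ℝ) / (2 * (B : ℝ))) atTop (nhds (1 / N)) := by
  have h1 : Tendsto (fun B : ℕ => (1 / 2 : ℝ) * (1 / (B : ℝ))) atTop (nhds 0) := by
    simpa using (tendsto_one_div_atTop_nhds_zero_nat (𝕜 := ℝ)).const_mul (1 / 2 : ℝ)
  rw [tendsto_iff_norm_sub_tendsto_zero]
  refine squeeze_zero' (Eventually.of_forall fun _ => norm_nonneg _) ?_ h1
  filter_upwards [eventually_gt_atTop 0] with B hB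
  have hB' : (0 : ℝ) < B := by exact_mod_cast hB
  have hN' : (0 : ℝ) < N := by exact_mod_cast hN
  have e : (cl N B t : ℝ) / (2 * (B : ℝ)) - 1 / N = ((cl N B t : ℝ) - 2 * B / N) / (2 * B) := by
    field_simp
  rw [e, norm_div, Real.norm_eq_abs, Real.norm_eq_abs, abs_of_pos (by positivity : 0 < 2 * (B : ℝ))]
  rw [div_le_iff₀ (by positivity)]
  have := cl_bound N B hN t
  calc _ ≤ (1 : ℝ) := this
    _ = _ := by field_simp

lemma HasPer.tendsto {d : ℕ} {S : Set (Fin d → ℤ)} {N : ℕ} {δ : ℝ} (h : HasPer S N δ) :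
    Tendsto (fun B : ℕ => (cnt S B : ℝ) / (2 * (B : ℝ)) ^ d) atTop (nhds δ) := by
  obtain ⟨hN, T, hT, hc⟩ := h
  have hN' : (N : ℝ) ≠ 0 := by exact_mod_cast hN.ne'
  have e : ∀ B : ℕ, (cnt S B : ℝ) / (2 * (B : ℝ)) ^ d =
      ∑ t ∈ T, ∏ i, ((cl N B (t i) : ℝ) / (2 * (B : ℝ))) := by
    intro B
    rw [cnt_red T S B hT]
    push_cast
    rw [Finset.sum_div]
    refine Finset.sum_congr rfl fun t _ => ?_
    rw [Finset.prod_div_distrib]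
    simp
  simp only [e]
  have : δ = ∑ t ∈ T, ∏ i : Fin d, (1 / (N : ℝ)) := by
    simp [hc]
    field_simp
  rw [this]
  exact tendsto_finsetSum _ fun t _ => tendsto_finsetProd _ fun i _ => cl_tendsto N hN _

/-- points determined up to `k` choices by the other coordinates are few -/
lemma cnt_fiber' {n : ℕ} (S : Set (Fin (n + 1) → ℤ)) (B k : ℕ) (j : Fin (n + 1))
    (U : (Fin n → ℤ) → Finset ℤ)
    (hU : ∀ b ∈ bx n B, (U b).card ≤ k)
    (hS : ∀ a ∈ bx (n + 1) B, a ∈ S → a j ∈ U (j.removeNth a)) :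
    cnt S B ≤ k * (2 * B) ^ n := by
  classical
  unfold cnt
  rw [← card_bx]
  refine Finset.card_le_mul_card_image_of_maps_to (f := fun a => j.removeNth a) ?_ k ?_
  · intro a ha
    have h1 := (Finset.mem_filter.1 ha).1
    rw [mem_bx] at h1 ⊢
    exact fun i => h1 _
  · intro b hb
    refine le_trans ?_ (hU b hb)
    refine Finset.card_le_card_of_injOn (fun a => a j) ?_ ?_
    · intro a ha
      simp only [Finset.coe_filter, Finset.mem_filter, Set.mem_ofPred_eq] at ha
      obtain ⟨⟨h1, h2⟩, rfl⟩ := ha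
      exact hS a h1 h2
    · intro a ha a' ha' h
      simp only [Finset.coe_filter, Finset.mem_filter, Set.mem_ofPred_eq] at ha ha'
      rw [← Fin.insertNth_self_removeNth j a, ← Fin.insertNth_self_removeNth j a', ha.2, ha'.2]
      simp only at h
      rw [h]

lemma cnt_fiber {n : ℕ} (S : Set (Fin (n + 1) → ℤ)) (B k : ℕ) (j : Fin (n + 1))
    (U : (Fin n → ℤ) → Finset ℤ)
    (hU : ∀ b, (U b).card ≤ k)
    (hS : ∀ a ∈ bx (n + 1) B, a ∈ S → a j ∈ U (j.removeNth a)) :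
    cnt S B ≤ k * (2 * B) ^ n :=
  cnt_fiber' S B k j U (fun b _ => hU b) hS

end PartD

section PartE

lemma cl_le (p B : ℕ) (hp : 0 < p) (hpB : p ≤ B) (t : ZMod p) : (cl p B t : ℝ) ≤ 3 * B / p := by
  have h := (abs_le.1 (cl_bound p B hp t)).2
  have hp' : (0 : ℝ) < p := by exact_mod_cast hp
  have h1 : (1 : ℝ) ≤ B / p := by rw [le_div_iff₀ hp', one_mul]; exact_mod_cast hpB
  have : 3 * (B : ℝ) / p = 2 * B / p + B / p := by ring
  linarith

lemma cl_le_two (p B : ℕ) (hpB : B < p) (t : ZMod p) : cl p B t ≤ 2 := by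
  have hp : 0 < p := by omega
  have h := (abs_le.1 (cl_bound p B hp t)).2
  have hp' : (0 : ℝ) < p := by exact_mod_cast hp
  have h1 : (B : ℝ) / p < 1 := by rw [div_lt_iff₀ hp', one_mul]; exact_mod_cast hpB
  have : 2 * (B : ℝ) / p = 2 * (B / p) := by ring
  have h2 : (cl p B t : ℝ) < 3 := by linarith
  have : cl p B t < 3 := by exact_mod_cast h2
  omega

lemma tail_small (p n B : ℕ) (hn : 2 ≤ n) (hp : p.Prime) (hpB : p ≤ B) :
    (cnt (ES p n) B : ℝ) ≤ 2 * (p : ℝ) ^ 2 * (3 * B / p) ^ (n + 1) := by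
  classical
  have : Fact p.Prime := ⟨hp⟩
  let F : ZMod p × ZMod p → (Fin (n + 1) → ZMod p) := fun x k =>
    x.1 * ((n.choose k : ZMod p) * 1 ^ (k : ℕ) * x.2 ^ (n - (k : ℕ)))
  let F' : ZMod p → (Fin (n + 1) → ZMod p) := fun x k =>
    x * ((n.choose k : ZMod p) * 0 ^ (k : ℕ) * 1 ^ (n - (k : ℕ)))
  let T : Finset (Fin (n + 1) → ZMod p) := Finset.univ.image F ∪ Finset.univ.image F'
  have hTc : T.card ≤ 2 * p ^ 2 := by
    refine (Finset.card_union_le _ _).trans ?_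
    have h1 : (Finset.univ.image F).card ≤ p ^ 2 := by
      refine Finset.card_image_le.trans ?_
      simp [ZMod.card, sq]
    have h2 : (Finset.univ.image F').card ≤ p := by
      refine Finset.card_image_le.trans ?_
      simp [ZMod.card]
    have : p ≤ p ^ 2 := Nat.le_self_pow two_ne_zero p
    omega
  have h1 : cnt (ES p n) B ≤ cnt {a | redV (n + 1) p a ∈ T} B := by
    refine cnt_mono B fun a _ ha => ?_
    obtain ⟨c, s, t, hst, h⟩ := ES_modp p n hn hp a ha
    have h' : ∀ k : Fin (n + 1), (a k : ZMod p) =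
        c * ((n.choose k : ZMod p) * s ^ (k : ℕ) * t ^ (n - (k : ℕ))) := by
      intro k
      have := (ZMod.intCast_zmod_eq_zero_iff_dvd _ _).2 (h k)
      push_cast at this
      exact sub_eq_zero.1 this
    show redV (n + 1) p a ∈ T
    rw [Finset.mem_union, Finset.mem_image, Finset.mem_image]
    rcases hst with rfl | ⟨rfl, rfl⟩
    · left
      refine ⟨(c, t), Finset.mem_univ _, ?_⟩
      ext k
      simp only [F, redV, h' k]
      push_cast; rfl
    · right
      refine ⟨c, Finset.mem_univ _, ?_⟩
      ext k
      simp only [F', redV, h' k]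
      push_cast; rfl
  have h2 := cnt_red T {a | redV (n + 1) p a ∈ T} B (fun a => Iff.rfl)
  calc (cnt (ES p n) B : ℝ) ≤ cnt {a | redV (n + 1) p a ∈ T} B := by exact_mod_cast h1
    _ = ∑ t ∈ T, ∏ i, (cl p B (t i) : ℝ) := by rw [h2]; push_cast; rfl
    _ ≤ ∑ t ∈ T, (3 * B / p : ℝ) ^ (n + 1) := by
        refine Finset.sum_le_sum fun t _ => ?_
        refine (Finset.prod_le_prod (fun i _ => Nat.cast_nonneg _)
          (fun i _ => cl_le p B hp.pos hpB (t i))).trans ?_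
        rw [Finset.prod_const, Finset.card_univ, Fintype.card_fin]
    _ = T.card * (3 * B / p : ℝ) ^ (n + 1) := by rw [Finset.sum_const, nsmul_eq_mul]
    _ ≤ _ := by
        gcongr
        exact_mod_cast hTc

lemma ES_GH (p n : ℕ) (hn : 3 ≤ n) (hp : p.Prime) (a : Fin (n + 1) → ℤ) (ha : a ∈ ES p n) :
    (p : ℤ) ∣ 2 * n * a ⟨0, by omega⟩ * a ⟨2, by omega⟩ - (n - 1) * a ⟨1, by omega⟩ ^ 2 ∧
    (p : ℤ) ∣ 3 * (n - 1) * a ⟨1, by omega⟩ * a ⟨3, by omega⟩ -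
      2 * (n - 2) * a ⟨2, by omega⟩ ^ 2 := by
  obtain ⟨c, s, t, -, h⟩ := ES_modp p n (by omega) hp a ha
  have h' : ∀ k : Fin (n + 1), (a k : ZMod p) =
      c * ((n.choose k : ZMod p) * s ^ (k : ℕ) * t ^ (n - (k : ℕ))) := by
    intro k
    have := (ZMod.intCast_zmod_eq_zero_iff_dvd _ _).2 (h k)
    push_cast at this
    exact sub_eq_zero.1 this
  obtain ⟨m, rfl⟩ : ∃ m, n = m + 3 := ⟨n - 3, by omega⟩
  have c2 : (((m + 3).choose 2 : ℕ) : ZMod p) * 2 = (m + 3) * (m + 2) := by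
    have := Nat.choose_succ_right_eq (m + 3) 1
    rw [Nat.choose_one_right] at this
    exact_mod_cast congrArg (Nat.cast : ℕ → ZMod p) this
  have c3 : (((m + 3).choose 3 : ℕ) : ZMod p) * 3 = (m + 3).choose 2 * (m + 1) := by
    have := Nat.choose_succ_right_eq (m + 3) 2
    exact_mod_cast congrArg (Nat.cast : ℕ → ZMod p) this
  have h0 := h' ⟨0, by omega⟩
  have h1 := h' ⟨1, by omega⟩
  have h2 := h' ⟨2, by omega⟩
  have h3 := h' ⟨3, by omega⟩
  simp only [Nat.choose_zero_right, Nat.choose_one_right, Nat.sub_zero,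
    show m + 3 - 1 = m + 2 by omega, show m + 3 - 2 = m + 1 by omega,
    show m + 3 - 3 = m by omega] at h0 h1 h2 h3
  rw [← ZMod.intCast_zmod_eq_zero_iff_dvd, ← ZMod.intCast_zmod_eq_zero_iff_dvd]
  push_cast at h0 h1 h2 h3 ⊢
  rw [h0, h1, h2, h3]
  generalize (((m + 3).choose 2 : ℕ) : ZMod p) = C2 at *
  generalize (((m + 3).choose 3 : ℕ) : ZMod p) = C3 at *
  constructor
  · linear_combination ((m : ZMod p) + 3) * c ^ 2 * s ^ 2 * t ^ (m + 3) * t ^ (m + 1) * c2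
  · linear_combination ((m : ZMod p) + 3) * (m + 2) * c ^ 2 * s ^ 4 * t ^ (m + 2) * t ^ m * c3 -
      ((m : ZMod p) + 1) * C2 * c ^ 2 * s ^ 4 * t ^ (m + 2) * t ^ m * c2

lemma few_primes (B : ℕ) (G : ℕ) (hG : G ≠ 0) (hB : G < B ^ 3) :
    (G.primeFactors.filter (fun q => B < q)).card ≤ 2 := by
  by_contra hcon
  push Not at hcon
  have h1 : ∏ q ∈ G.primeFactors.filter (fun q => B < q), q ∣ G :=
    (Finset.prod_dvd_prod_of_subset _ _ _ (Finset.filter_subset _ _)).trans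
      (Nat.prod_primeFactors_dvd G)
  have h2 := Nat.le_of_dvd (Nat.pos_of_ne_zero hG) h1
  have hB0 : 0 < B := by
    rcases Nat.eq_zero_or_pos B with rfl | h
    · simp at hB
    · exact h
  have h3 : B ^ (G.primeFactors.filter (fun q => B < q)).card ≤
      ∏ q ∈ G.primeFactors.filter (fun q => B < q), q :=
    Finset.pow_card_le_prod _ _ _ fun q hq => (Finset.mem_filter.1 hq).2.le
  have h4 : B ^ 3 ≤ B ^ (G.primeFactors.filter (fun q => B < q)).card :=
    Nat.pow_le_pow_right hB0 hcon
  omega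

lemma succAbove_three (n i : ℕ) (hn : 3 ≤ n) (hi : i < 3) :
    (⟨3, by omega⟩ : Fin (n + 1)).succAbove ⟨i, by omega⟩ = ⟨i, by omega⟩ := by
  rw [Fin.succAbove_of_castSucc_lt]
  · rfl
  · rw [Fin.lt_def]; exact hi

lemma tail_large (n B : ℕ) (hn : 3 ≤ n) (hB : 3 * n < B) :
    cnt {a : Fin (n + 1) → ℤ | ∃ p : ℕ, p.Prime ∧ B < p ∧ a ∈ ES p n} B ≤ 7 * (2 * B) ^ n := by
  classical
  let S1 : Set (Fin (n + 1) → ℤ) := {a | a ⟨1, by omega⟩ = 0}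
  let S2 : Set (Fin (n + 1) → ℤ) := {a | a ⟨2, by omega⟩ = 0}
  let S3 : Set (Fin (n + 1) → ℤ) := {a | a ⟨2, by omega⟩ ≠ 0 ∧
    2 * n * a ⟨0, by omega⟩ * a ⟨2, by omega⟩ - (n - 1) * a ⟨1, by omega⟩ ^ 2 = 0}
  let S4 : Set (Fin (n + 1) → ℤ) := {a | a ⟨1, by omega⟩ ≠ 0 ∧
    2 * n * a ⟨0, by omega⟩ * a ⟨2, by omega⟩ - (n - 1) * a ⟨1, by omega⟩ ^ 2 ≠ 0 ∧
    ∃ p : ℕ, p.Prime ∧ B < p ∧ a ∈ ES p n}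
  have b1 : cnt S1 B ≤ 1 * (2 * B) ^ n :=
    cnt_fiber S1 B 1 ⟨1, by omega⟩ (fun _ => {0}) (by simp) (fun a _ ha => Finset.mem_singleton.2 ha)
  have b2 : cnt S2 B ≤ 1 * (2 * B) ^ n :=
    cnt_fiber S2 B 1 ⟨2, by omega⟩ (fun _ => {0}) (by simp) (fun a _ ha => Finset.mem_singleton.2 ha)
  have b3 : cnt S3 B ≤ 1 * (2 * B) ^ n := by
    refine cnt_fiber S3 B 1 ⟨0, by omega⟩
      (fun b => {((n - 1) * b ⟨0, by omega⟩ ^ 2) / (2 * n * b ⟨1, by omega⟩)}) (by simp) ?_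
    rintro a - ⟨h1, h2⟩
    have e1 : (Fin.removeNth ⟨0, by omega⟩ a : Fin n → ℤ) ⟨0, by omega⟩ = a ⟨1, by omega⟩ := rfl
    have e2 : (Fin.removeNth ⟨0, by omega⟩ a : Fin n → ℤ) ⟨1, by omega⟩ = a ⟨2, by omega⟩ := rfl
    simp only [e1, e2, Finset.mem_singleton]
    refine Int.eq_ediv_of_mul_eq_right (mul_ne_zero (by omega) h1) ?_
    linear_combination h2
  have b4 : cnt S4 B ≤ 4 * (2 * B) ^ n := by
    let G : (Fin n → ℤ) → ℤ := fun b =>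
      2 * n * b ⟨0, by omega⟩ * b ⟨2, by omega⟩ - (n - 1) * b ⟨1, by omega⟩ ^ 2
    let Q : (Fin n → ℤ) → Finset ℕ := fun b => (G b).natAbs.primeFactors.filter (fun q => B < q)
    let V : (Fin n → ℤ) → ℕ → Finset ℤ := fun b q => (Finset.Ico (-(B : ℤ)) B).filter fun x =>
      (q : ℤ) ∣ 3 * (n - 1) * b ⟨1, by omega⟩ * x - 2 * (n - 2) * b ⟨2, by omega⟩ ^ 2
    have hQ : ∀ b ∈ bx n B, G b ≠ 0 → (Q b).card ≤ 2 := by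
      intro b hb hG
      refine few_primes B _ (by simpa using hG) ?_
      have hb' := (mem_bx _ _ _).1 hb
      have g0 := hb' ⟨0, by omega⟩
      have g1 := hb' ⟨1, by omega⟩
      have g2 := hb' ⟨2, by omega⟩
      have hab : |G b| ≤ 3 * n * B ^ 2 := by
        have i0 : |b ⟨0, by omega⟩| ≤ (B : ℤ) := abs_le.2 ⟨g0.1, g0.2.le⟩
        have i1 : |b ⟨1, by omega⟩| ≤ (B : ℤ) := abs_le.2 ⟨g1.1, g1.2.le⟩
        have i2 : |b ⟨2, by omega⟩| ≤ (B : ℤ) := abs_le.2 ⟨g2.1, g2.2.le⟩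
        have hn1 : (0 : ℤ) ≤ (n : ℤ) - 1 := by omega
        calc |G b| ≤ |2 * n * b ⟨0, by omega⟩ * b ⟨2, by omega⟩| +
              |(n - 1) * b ⟨1, by omega⟩ ^ 2| := abs_sub _ _
          _ = 2 * n * (|b ⟨0, by omega⟩| * |b ⟨2, by omega⟩|) +
              (n - 1) * |b ⟨1, by omega⟩| ^ 2 := by
              rw [abs_mul, abs_mul, abs_mul, abs_mul, abs_pow, abs_of_nonneg hn1]
              simp
              ring
          _ ≤ 2 * n * (B * B) + (n - 1) * B ^ 2 := by gcongr
          _ ≤ 3 * n * B ^ 2 := by nlinarith [sq_nonneg (B : ℤ)]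
      have : |G b| < B ^ 3 := by
        refine hab.trans_lt ?_
        have h1 : (3 * n : ℤ) < B := by exact_mod_cast hB
        have h2 : (0 : ℤ) < (B : ℤ) ^ 2 := by
          have : (0 : ℤ) < B := by omega
          positivity
        nlinarith
      rw [Int.abs_eq_natAbs] at this
      exact_mod_cast this
    have hV : ∀ b ∈ bx n B, b ⟨1, by omega⟩ ≠ 0 → ∀ q : ℕ, q.Prime → B < q → (V b q).card ≤ 2 := by
      intro b hb hb1 q hq hBq
      have : Fact q.Prime := ⟨hq⟩
      have hb' := (mem_bx _ _ _).1 hb ⟨1, by omega⟩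
      have hqz : Prime (q : ℤ) := Nat.prime_iff_prime_int.1 hq
      have nd : ∀ z : ℤ, z ≠ 0 → |z| < q → ¬ (q : ℤ) ∣ z := fun z h0 h1 h2 =>
        h0 (Int.eq_zero_of_abs_lt_dvd h2 h1)
      have hA : ¬ (q : ℤ) ∣ 3 * (n - 1) * b ⟨1, by omega⟩ := by
        intro h
        rcases hqz.dvd_or_dvd h with h | h
        · exact nd (3 * (n - 1)) (by omega) (by rw [abs_lt]; constructor <;> omega) h
        · exact nd _ hb1 (by rw [abs_lt]; constructor <;> omega) h
      have hA' : ((3 * (n - 1) * b ⟨1, by omega⟩ : ℤ) : ZMod q) ≠ 0 := by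
        rwa [Ne, ZMod.intCast_zmod_eq_zero_iff_dvd]
      refine le_trans (Finset.card_le_card ?_) (cl_le_two q B hBq
        (((2 * (n - 2) * b ⟨2, by omega⟩ ^ 2 : ℤ) : ZMod q) /
          ((3 * (n - 1) * b ⟨1, by omega⟩ : ℤ) : ZMod q)))
      intro x hx
      simp only [V, Finset.mem_filter] at hx ⊢
      refine ⟨hx.1, ?_⟩
      rw [eq_div_iff hA']
      have := (ZMod.intCast_zmod_eq_zero_iff_dvd _ _).2 hx.2
      push_cast at this ⊢
      linear_combination this
    refine cnt_fiber' S4 B 4 ⟨3, by omega⟩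
      (fun b => if b ⟨1, by omega⟩ ≠ 0 ∧ G b ≠ 0 then (Q b).biUnion (V b) else ∅) ?_ ?_
    · intro b hb
      split_ifs with h
      · refine (Finset.card_biUnion_le_card_mul _ _ 2 fun q hq => ?_).trans ?_
        · have hq' := Finset.mem_filter.1 hq
          exact hV b hb h.1 q (Nat.prime_of_mem_primeFactors hq'.1) hq'.2
        · have := hQ b hb h.2; omega
      · simp
    · rintro a hab ⟨h1, h2, p, hp, hBp, hE⟩
      have e0 : (Fin.removeNth ⟨3, by omega⟩ a : Fin n → ℤ) ⟨0, by omega⟩ = a ⟨0, by omega⟩ :=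
        congrArg a (succAbove_three n 0 hn (by omega))
      have e1 : (Fin.removeNth ⟨3, by omega⟩ a : Fin n → ℤ) ⟨1, by omega⟩ = a ⟨1, by omega⟩ :=
        congrArg a (succAbove_three n 1 hn (by omega))
      have e2 : (Fin.removeNth ⟨3, by omega⟩ a : Fin n → ℤ) ⟨2, by omega⟩ = a ⟨2, by omega⟩ :=
        congrArg a (succAbove_three n 2 hn (by omega))
      have hG : G (Fin.removeNth ⟨3, by omega⟩ a : Fin n → ℤ) =
        2 * n * a ⟨0, by omega⟩ * a ⟨2, by omega⟩ - (n - 1) * a ⟨1, by omega⟩ ^ 2 := by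
        simp only [G, e0, e1, e2]
      obtain ⟨k1, k2⟩ := ES_GH p n hn hp a hE
      rw [if_pos ⟨by rw [e1]; exact h1, by rw [hG]; exact h2⟩, Finset.mem_biUnion]
      refine ⟨p, ?_, ?_⟩
      · simp only [Q, Finset.mem_filter, Nat.mem_primeFactors, hG]
        exact ⟨⟨hp, Int.natCast_dvd.1 k1, by simpa using h2⟩, hBp⟩
      · simp only [V, Finset.mem_filter, e1, e2, Finset.mem_Ico]
        exact ⟨(mem_bx _ _ _).1 hab _, k2⟩
  have hcov : cnt {a : Fin (n + 1) → ℤ | ∃ p : ℕ, p.Prime ∧ B < p ∧ a ∈ ES p n} B ≤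
      cnt (S1 ∪ (S2 ∪ (S3 ∪ S4))) B := by
    refine cnt_mono B fun a _ ha => ?_
    show a ∈ S1 ∨ a ∈ S2 ∨ a ∈ S3 ∨ a ∈ S4
    by_cases h1 : a ∈ S1
    · exact Or.inl h1
    by_cases h2 : a ∈ S2
    · exact Or.inr (Or.inl h2)
    by_cases h3 : a ∈ S3
    · exact Or.inr (Or.inr (Or.inl h3))
    · exact Or.inr (Or.inr (Or.inr ⟨h1, fun h => h3 ⟨h2, h⟩, ha⟩))
  have u1 := cnt_union S1 (S2 ∪ (S3 ∪ S4)) B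
  have u2 := cnt_union S2 (S3 ∪ S4) B
  have u3 := cnt_union S3 S4 B
  omega

end PartE

section PartF

lemma cnt_biUnion {d : ℕ} (s : Finset ℕ) (S : ℕ → Set (Fin d → ℤ)) (B : ℕ) :
    cnt (⋃ p ∈ s, S p) B ≤ ∑ p ∈ s, cnt (S p) B := by
  classical
  induction s using Finset.induction_on with
  | empty => simp [cnt]
  | insert q s hq ih =>
    rw [Finset.sum_insert hq, Finset.set_biUnion_insert]
    exact (cnt_union _ _ _).trans (Nat.add_le_add_left ih _)

lemma tail_bound (n M B : ℕ) (hn : 3 ≤ n) (hB : 3 * n < B) :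
    (cnt {a : Fin (n + 1) → ℤ | ∃ p : ℕ, p.Prime ∧ M ≤ p ∧ a ∈ ES p n} B : ℝ) /
      (2 * (B : ℝ)) ^ (n + 1) ≤
    2 * (3 / 2) ^ (n + 1) * ∑ p ∈ (Finset.Icc M B).filter Nat.Prime, 1 / (p : ℝ) ^ 2 +
      7 / (2 * (B : ℝ)) := by
  have hB0 : (0 : ℝ) < B := by exact_mod_cast (by omega : 0 < B)
  have h1 : cnt {a : Fin (n + 1) → ℤ | ∃ p : ℕ, p.Prime ∧ M ≤ p ∧ a ∈ ES p n} B ≤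
      ∑ p ∈ (Finset.Icc M B).filter Nat.Prime, cnt (ES p n) B + 7 * (2 * B) ^ n := by
    refine le_trans ?_ (Nat.add_le_add (cnt_biUnion _ _ B) (tail_large n B hn hB))
    refine le_trans (cnt_mono B fun a _ ha => ?_) (cnt_union _ _ B)
    obtain ⟨p, hp, hMp, hE⟩ := ha
    by_cases hpB : p ≤ B
    · left
      simp only [Set.mem_iUnion]
      exact ⟨p, by simp [hMp, hpB, hp], hE⟩
    · right
      exact ⟨p, hp, by omega, hE⟩
  have h2 : ∀ p ∈ (Finset.Icc M B).filter Nat.Prime, (cnt (ES p n) B : ℝ) ≤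
      (2 * (3 / 2) ^ (n + 1) * (1 / (p : ℝ) ^ 2)) * (2 * (B : ℝ)) ^ (n + 1) := by
    intro p hp
    simp only [Finset.mem_filter, Finset.mem_Icc] at hp
    refine (tail_small p n B (by omega) hp.2 hp.1.2).trans ?_
    have hp0 : (1 : ℝ) ≤ p := by exact_mod_cast hp.2.one_le
    have e : (2 * (3 / 2) ^ (n + 1) * (1 / (p : ℝ) ^ 2)) * (2 * (B : ℝ)) ^ (n + 1) =
        2 * (1 / (p : ℝ) ^ 2) * (3 * B) ^ (n + 1) := by
      have : (3 * (B : ℝ)) ^ (n + 1) = (3 / 2) ^ (n + 1) * (2 * B) ^ (n + 1) := by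
        rw [← mul_pow]; congr 1; ring
      rw [this]; ring
    rw [e, div_pow, ← mul_div_assoc, div_le_iff₀ (by positivity)]
    have h4 : (p : ℝ) ^ 4 ≤ (p : ℝ) ^ (n + 1) := pow_le_pow_right₀ hp0 (by omega)
    have h5 : (p : ℝ) ^ 2 ≤ 1 / (p : ℝ) ^ 2 * (p : ℝ) ^ (n + 1) := by
      rw [one_div, inv_mul_eq_div, le_div_iff₀ (by positivity)]
      calc _ = (p : ℝ) ^ 4 := by ring
        _ ≤ _ := h4
    calc 2 * (p : ℝ) ^ 2 * (3 * (B : ℝ)) ^ (n + 1)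
        ≤ 2 * (1 / (p : ℝ) ^ 2 * (p : ℝ) ^ (n + 1)) * (3 * (B : ℝ)) ^ (n + 1) := by gcongr
      _ = _ := by ring
  have h3 : (cnt {a : Fin (n + 1) → ℤ | ∃ p : ℕ, p.Prime ∧ M ≤ p ∧ a ∈ ES p n} B : ℝ) ≤
      ∑ p ∈ (Finset.Icc M B).filter Nat.Prime, (cnt (ES p n) B : ℝ) + 7 * (2 * (B : ℝ)) ^ n := by
    exact_mod_cast h1
  rw [div_le_iff₀ (by positivity)]
  refine h3.trans ?_
  rw [add_mul, Finset.mul_sum, Finset.sum_mul]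
  refine add_le_add (Finset.sum_le_sum h2) (le_of_eq ?_)
  rw [pow_succ]
  field_simp

lemma sum_tail (ε : ℝ) (hε : 0 < ε) : ∃ M : ℕ, ∀ t : Finset ℕ, (∀ k ∈ t, M ≤ k) →
    ∑ k ∈ t, 1 / (k : ℝ) ^ 2 < ε := by
  have hs : Summable (fun k : ℕ => 1 / (k : ℝ) ^ 2) :=
    Real.summable_one_div_nat_pow.2 (by norm_num)
  obtain ⟨s, hs⟩ := summable_iff_vanishing_norm.1 hs ε hε
  refine ⟨s.sup id + 1, fun t ht => ?_⟩
  refine (le_abs_self _).trans_lt (hs t ?_)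
  rw [Finset.disjoint_left]
  intro k hk hks
  have h1 := ht k hk
  have h2 := Finset.le_sup (f := id) hks
  simp only [id] at h2
  omega

lemma mult_primes (n : ℕ) (hn : 3 ≤ n) : Multipliable fun q : Nat.Primes =>
    (1 - ((q : ℝ) + 1) * ((q : ℝ) - 1) ^ 2 / (q : ℝ) ^ (n + 2)) := by
  simp only [sub_eq_add_neg (1 : ℝ)]
  apply Real.multipliable_one_add_of_summable
  apply Summable.neg
  have hs : Summable (fun k : ℕ => 2 * (1 / (k : ℝ) ^ 2)) :=
    (Real.summable_one_div_nat_pow.2 (by norm_num)).mul_left 2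
  have hs' : Summable (fun q : Nat.Primes => 2 * (1 / ((q : ℕ) : ℝ) ^ 2)) :=
    hs.comp_injective (i := fun q : Nat.Primes => (q : ℕ)) Subtype.val_injective
  refine Summable.of_nonneg_of_le (fun q => by positivity) (fun q => ?_) hs'
  have hq : (1 : ℝ) ≤ ((q : ℕ) : ℝ) := by exact_mod_cast q.2.one_le
  rw [div_le_iff₀ (by positivity)]
  generalize ((q : ℕ) : ℝ) = x at *
  have h5 : x ^ 5 ≤ x ^ (n + 2) := pow_le_pow_right₀ hq (by omega)
  have h3 : (x + 1) * (x - 1) ^ 2 ≤ 2 * x ^ 3 := by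
    have a1 : x + 1 ≤ 2 * x := by linarith
    have a2 : (x - 1) ^ 2 ≤ x ^ 2 := by nlinarith
    calc _ ≤ (2 * x) * x ^ 2 := by gcongr
      _ = _ := by ring
  refine h3.trans ?_
  calc 2 * x ^ 3 = 2 * (1 / x ^ 2) * x ^ 5 := by field_simp
    _ ≤ _ := by gcongr

lemma main_density (n : ℕ) (hn : 3 ≤ n) :
    Tendsto (fun B : ℕ => (cnt {a : Fin (n + 1) → ℤ | ∃ p : ℕ, p.Prime ∧ a ∈ ES p n} B : ℝ) /
      (2 * (B : ℝ)) ^ (n + 1)) atTop (nhds (1 - ∏' q : Nat.Primes,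
        (1 - ((q : ℝ) + 1) * ((q : ℝ) - 1) ^ 2 / (q : ℝ) ^ (n + 2)))) := by
  classical
  rw [Metric.tendsto_atTop']
  intro ε hε
  have hP := (mult_primes n hn).hasProd
  set P := ∏' q : Nat.Primes, (1 - ((q : ℝ) + 1) * ((q : ℝ) - 1) ^ 2 / (q : ℝ) ^ (n + 2))
  set K : ℝ := 2 * (3 / 2) ^ (n + 1) with hK
  have hK0 : 0 < K := by positivity
  obtain ⟨s0, hs0⟩ := (Metric.tendsto_atTop.1 (show Tendsto _ atTop _ from hP)) (ε / 4) (by positivity)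
  obtain ⟨M, hM⟩ := sum_tail (ε / 4 / K) (by positivity)
  have hfin : {q : Nat.Primes | (q : ℕ) < M}.Finite :=
    Set.Finite.preimage (f := fun q : Nat.Primes => (q : ℕ)) Subtype.val_injective.injOn
      (Set.finite_lt_nat M)
  let s := s0 ∪ hfin.toFinset
  have hs := hs0 s Finset.subset_union_left
  have hg := (union_hasPer n (by omega) s).tendsto
  obtain ⟨B1, hB1⟩ := Metric.tendsto_atTop.1 hg (ε / 4) (by positivity)
  obtain ⟨B2, hB2⟩ := exists_nat_gt (28 / (2 * ε))
  refine ⟨max (3 * n) (max B1 B2), fun B hB => ?_⟩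
  have hBn : 3 * n < B := lt_of_le_of_lt (le_max_left _ _) hB
  have hBB1 : B1 ≤ B := ((le_max_left _ _).trans (le_max_right _ _)).trans hB.le
  have hBB2 : B2 ≤ B := ((le_max_right _ _).trans (le_max_right _ _)).trans hB.le
  have hB0 : (0 : ℝ) < B := by exact_mod_cast (by omega : 0 < B)
  have hg1 := hB1 B hBB1
  have ht := tail_bound n M B hn hBn
  have hsum := hM ((Finset.Icc M B).filter Nat.Prime) (fun k hk => by
    simp only [Finset.mem_filter, Finset.mem_Icc] at hk; exact hk.1.1)
  have h7 : 7 / (2 * (B : ℝ)) < ε / 4 := by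
    have : (28 / (2 * ε)) < B := hB2.trans_le (by exact_mod_cast hBB2)
    rw [div_lt_iff₀ (by positivity)] at this ⊢
    linarith
  have hKs : K * ∑ p ∈ (Finset.Icc M B).filter Nat.Prime, 1 / (p : ℝ) ^ 2 < ε / 4 := by
    calc _ < K * (ε / 4 / K) := by gcongr
      _ = _ := by field_simp
  have hlo : cnt (⋃ q ∈ s, (ES (q : ℕ) n)) B ≤
      cnt {a : Fin (n + 1) → ℤ | ∃ p : ℕ, p.Prime ∧ a ∈ ES p n} B := by
    refine cnt_mono B fun a _ ha => ?_
    simp only [Set.mem_iUnion] at ha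
    obtain ⟨q, _, hq⟩ := ha
    exact ⟨q, q.2, hq⟩
  have hhi : cnt {a : Fin (n + 1) → ℤ | ∃ p : ℕ, p.Prime ∧ a ∈ ES p n} B ≤
      cnt (⋃ q ∈ s, (ES (q : ℕ) n)) B +
      cnt {a : Fin (n + 1) → ℤ | ∃ p : ℕ, p.Prime ∧ M ≤ p ∧ a ∈ ES p n} B := by
    refine le_trans (cnt_mono B fun a _ ha => ?_) (cnt_union _ _ B)
    obtain ⟨p, hp, hE⟩ := ha
    by_cases hpM : M ≤ p
    · right; exact ⟨p, hp, hpM, hE⟩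
    · left
      simp only [Set.mem_iUnion]
      exact ⟨⟨p, hp⟩, Finset.mem_union_right _ (hfin.mem_toFinset.2 (not_le.1 hpM)), hE⟩
  have hD : (0 : ℝ) < (2 * (B : ℝ)) ^ (n + 1) := by positivity
  have hlo' : (cnt (⋃ q ∈ s, (ES (q : ℕ) n)) B : ℝ) / (2 * (B : ℝ)) ^ (n + 1) ≤
      (cnt {a : Fin (n + 1) → ℤ | ∃ p : ℕ, p.Prime ∧ a ∈ ES p n} B : ℝ) /
        (2 * (B : ℝ)) ^ (n + 1) := by
    gcongr
  have hhi' : (cnt {a : Fin (n + 1) → ℤ | ∃ p : ℕ, p.Prime ∧ a ∈ ES p n} B : ℝ) /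
        (2 * (B : ℝ)) ^ (n + 1) ≤
      (cnt (⋃ q ∈ s, (ES (q : ℕ) n)) B : ℝ) / (2 * (B : ℝ)) ^ (n + 1) +
      (cnt {a : Fin (n + 1) → ℤ | ∃ p : ℕ, p.Prime ∧ M ≤ p ∧ a ∈ ES p n} B : ℝ) /
        (2 * (B : ℝ)) ^ (n + 1) := by
    rw [← add_div]
    gcongr
    exact_mod_cast hhi
  rw [Real.dist_eq, abs_lt] at *
  constructor <;> linarith [hs.1, hs.2, hg1.1, hg1.2]

end PartF

/-- For `n ≥ 3`, the natural density of the set of affine Eisenstein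
polynomials of degree `n` (degree-`n` polynomials over `ℤ`, identified with
`ℤ^{n+1}`, that become `p`-Eisenstein of degree `n` after an affine
transformation by some integer matrix, for some prime `p`) exists and equals
`1 - ∏_p (1 - (p+1)(p-1)²/p^{n+2})`, the product running over all primes. -/
theorem density_affEisenstein (n : ℕ) (hn : 3 ≤ n) :
    Tendsto (fun B : ℕ =>
      (({a : Fin (n + 1) → ℤ |
          ((toPolyZ n a).natDegree = n ∧
            ∃ p : ℕ, p.Prime ∧ ∃ A : Matrix (Fin 2) (Fin 2) ℤ,
              IsEisensteinZ p n (affTrans n (toPolyZ n a) A)) ∧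
          ∀ j, -(B : ℤ) ≤ a j ∧ a j < B}.ncard : ℝ)) / (2 * (B : ℝ)) ^ (n + 1))
      atTop
      (nhds (1 - ∏' q : Nat.Primes,
        (1 - ((q : ℝ) + 1) * ((q : ℝ) - 1) ^ 2 / (q : ℝ) ^ (n + 2)))) := by
  classical
  refine (main_density n hn).congr fun B => ?_
  congr 2
  rw [cnt, ← Set.ncard_coe_finset]
  congr 1
  ext a
  simp only [Finset.coe_filter, Set.mem_ofPred_eq, mem_bx]
  constructor
  · rintro ⟨h1, p, hp, hE⟩
    exact ⟨⟨ES_natDegree p n (by omega) hp a hE, p, hp, hE⟩, h1⟩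
  · rintro ⟨⟨_, p, hp, hE⟩, h1⟩
    exact ⟨h1, p, hp, hE⟩
end
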